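/- Let 1/4 < s ≤ 1, 1/4 < s' ≤ 1/2 with s < 2s' + 1/4, and let 1/2 < θ₀ < 3/4 and 1/2 < θ₁ < 3/4. Then there exists ε₀ > 0 such that for every ε with 0 < ε ≤ ε₀ there exists a constant C > 0 such that for all Schwartz functions u, v, w on ℝ^{1+2}, ‖uvw‖_{H^{s−1, θ₀−1+ε}} ≤ C ‖u‖_{H^{s,θ₀}} ‖v‖_{H^{s',θ₁}} ‖w‖_{H^{s',θ₁}}. -/

import Mathlib

open MeasureTheory Real
open scoped FourierTransform

noncomputable section

/-- Space-time ℝ^{1+2}: coordinate 0 is time `t`, coordinates 1,2 are space `x`. -/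
abbrev SpaceTime := EuclideanSpace ℝ (Fin 3)

/-- The magnitude `|ξ|` of the spatial part of a frequency point `(τ, ξ) ∈ ℝ × ℝ²`. -/
def spFreq (ζ : SpaceTime) : ℝ := Real.sqrt ((ζ 1) ^ 2 + (ζ 2) ^ 2)

/-- The wave-Sobolev norm
`‖u‖_{H^{s,b}} = (∫ (1+|ξ|²)^s (1+||τ|-|ξ||)^{2b} |û(τ,ξ)|² dτ dξ)^{1/2}`. -/
def waveNorm (s b : ℝ) (f : SpaceTime → ℂ) : ℝ :=
  (∫ ζ : SpaceTime, (1 + (spFreq ζ) ^ 2) ^ s * (1 + |(|ζ 0| - spFreq ζ)|) ^ (2 * b) *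
    ‖𝓕 f ζ‖ ^ 2) ^ (1/2 : ℝ)

open scoped ENNReal

section Quadrilinear

/-- Cauchy–Schwarz for the lower Lebesgue integral, in squared form. -/
theorem sq_lintegral_mul_le {α : Type*} [MeasurableSpace α] (μ : Measure α) {f g : α → ℝ≥0∞}
    (hf : AEMeasurable f μ) (hg : AEMeasurable g μ) :
    (∫⁻ a, f a * g a ∂μ) ^ 2 ≤ (∫⁻ a, f a ^ 2 ∂μ) * ∫⁻ a, g a ^ 2 ∂μ := by
  have h := ENNReal.lintegral_mul_le_Lp_mul_Lq μ Real.HolderConjugate.two_two hf hg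
  simp only [Pi.mul_apply, ENNReal.rpow_two] at h
  calc _ ≤ ((∫⁻ a, f a ^ 2 ∂μ) ^ (1 / 2 : ℝ) * (∫⁻ a, g a ^ 2 ∂μ) ^ (1 / 2 : ℝ)) ^ 2 := by gcongr
    _ = _ := by
      rw [mul_pow, ← ENNReal.rpow_natCast, ← ENNReal.rpow_natCast, ← ENNReal.rpow_mul,
        ← ENNReal.rpow_mul]
      norm_num

variable {E : Type*} [AddCommGroup E] [MeasurableSpace E] [MeasurableAdd₂ E] [MeasurableNeg E]
  (μ : Measure E) [SFinite μ] [μ.IsAddLeftInvariant]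

/-- A weighted convolution is bounded on `L²` by the largest `L²` norm of its kernel along fibres
of the addition map. -/
theorem lintegral_sq_weighted_conv_le {f g : E → ℝ≥0∞} {p : E → E → ℝ≥0∞}
    (hf : Measurable f) (hg : Measurable g) (hp : Measurable (Function.uncurry p)) {K : ℝ≥0∞}
    (hK : ∀ S, ∫⁻ X, p X (S - X) ^ 2 ∂μ ≤ K) :
    ∫⁻ S, (∫⁻ X, f X * g (S - X) * p X (S - X) ∂μ) ^ 2 ∂μ ≤
      K * ((∫⁻ X, f X ^ 2 ∂μ) * ∫⁻ X, g X ^ 2 ∂μ) := by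
  have hp' : Measurable fun x : E × E => p x.2 (x.1 - x.2) :=
    hp.comp (f := fun x : E × E => (x.2, x.1 - x.2)) (by fun_prop)
  calc ∫⁻ S, (∫⁻ X, f X * g (S - X) * p X (S - X) ∂μ) ^ 2 ∂μ
      ≤ ∫⁻ S, (∫⁻ X, f X ^ 2 * g (S - X) ^ 2 ∂μ) * K ∂μ := by
        refine lintegral_mono fun S => ?_
        refine (sq_lintegral_mul_le μ (by fun_prop)
          (hp'.comp (measurable_prodMk_left (x := S))).aemeasurable).trans ?_
        simp only [mul_pow]
        gcongr
        exact hK S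
    _ = K * ∫⁻ S, ∫⁻ X, f X ^ 2 * g (S - X) ^ 2 ∂μ ∂μ := by
        rw [lintegral_mul_const _ (Measurable.lintegral_prod_right' (f := fun x : E × E =>
          f x.2 ^ 2 * g (x.1 - x.2) ^ 2) (by fun_prop)), mul_comm]
    _ = _ := by
        rw [lintegral_lintegral_swap (by fun_prop)]
        congr 1
        rw [← lintegral_mul_const _ (by fun_prop)]
        refine lintegral_congr fun X => ?_
        rw [lintegral_const_mul _ (by fun_prop), lintegral_sub_right_eq_self (fun S => g S ^ 2) X]

/-- The quadrilinear form attached to the hyperplane `X + Y + Z + W = 0`, with a weight that splits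
over the pairs `(X, Y)` and `(Z, W)`. -/
theorem sq_quadrilinear_le [μ.IsNegInvariant] {f₁ f₂ f₃ f₄ : E → ℝ≥0∞} {p q : E → E → ℝ≥0∞}
    (h₁ : Measurable f₁) (h₂ : Measurable f₂) (h₃ : Measurable f₃) (h₄ : Measurable f₄)
    (hp : Measurable (Function.uncurry p)) (hq : Measurable (Function.uncurry q)) {K L : ℝ≥0∞}
    (hK : ∀ S, ∫⁻ X, p X (S - X) ^ 2 ∂μ ≤ K) (hL : ∀ S, ∫⁻ X, q X (S - X) ^ 2 ∂μ ≤ L) :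
    (∫⁻ X, ∫⁻ Y, ∫⁻ Z, f₁ X * f₂ Y * p X Y *
        (f₃ Z * f₄ (-X - Y - Z) * q Z (-X - Y - Z)) ∂μ ∂μ ∂μ) ^ 2 ≤
      (K * ((∫⁻ X, f₁ X ^ 2 ∂μ) * ∫⁻ X, f₂ X ^ 2 ∂μ)) *
        (L * ((∫⁻ X, f₃ X ^ 2 ∂μ) * ∫⁻ X, f₄ X ^ 2 ∂μ)) := by
  set A : E → ℝ≥0∞ := fun S => ∫⁻ X, f₁ X * f₂ (S - X) * p X (S - X) ∂μ with hA
  set B : E → ℝ≥0∞ := fun S => ∫⁻ Z, f₃ Z * f₄ (S - Z) * q Z (S - Z) ∂μ with hB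
  have hp' : Measurable fun x : E × E => p x.2 (x.1 - x.2) :=
    hp.comp (f := fun x : E × E => (x.2, x.1 - x.2)) (by fun_prop)
  have hq' : Measurable fun x : E × E => q x.2 (x.1 - x.2) :=
    hq.comp (f := fun x : E × E => (x.2, x.1 - x.2)) (by fun_prop)
  have hAm : Measurable A := Measurable.lintegral_prod_right'
    (f := fun x : E × E => f₁ x.2 * f₂ (x.1 - x.2) * p x.2 (x.1 - x.2)) (by fun_prop)
  have hBm : Measurable B := Measurable.lintegral_prod_right'
    (f := fun x : E × E => f₃ x.2 * f₄ (x.1 - x.2) * q x.2 (x.1 - x.2)) (by fun_prop)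
  have key : ∫⁻ X, ∫⁻ Y, ∫⁻ Z, f₁ X * f₂ Y * p X Y *
        (f₃ Z * f₄ (-X - Y - Z) * q Z (-X - Y - Z)) ∂μ ∂μ ∂μ = ∫⁻ S, A S * B (-S) ∂μ := by
    calc _ = ∫⁻ X, ∫⁻ Y, f₁ X * f₂ Y * p X Y * B (-(Y + X)) ∂μ ∂μ := by
          refine lintegral_congr fun X => lintegral_congr fun Y => ?_
          have e : -X - Y = -(Y + X) := by abel
          simp only [e, hB]
          rw [lintegral_const_mul]
          exact (h₃.mul (h₄.comp (by fun_prop))).mul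
            (hq'.comp (measurable_prodMk_left (x := -(Y + X))))
      _ = ∫⁻ X, ∫⁻ S, f₁ X * f₂ (S - X) * p X (S - X) * B (-S) ∂μ ∂μ := by
          refine lintegral_congr fun X => ?_
          rw [← lintegral_sub_right_eq_self (fun Y => f₁ X * f₂ Y * p X Y * B (-(Y + X))) X]
          simp
      _ = _ := by
          rw [lintegral_lintegral_swap]
          · refine lintegral_congr fun S => ?_
            rw [hA, lintegral_mul_const]
            exact (h₁.mul (h₂.comp (by fun_prop))).mul
              (hp'.comp (measurable_prodMk_left (x := S)))
          · have : Measurable fun x : E × E => p x.1 (x.2 - x.1) :=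
              hp.comp (f := fun x : E × E => (x.1, x.2 - x.1)) (by fun_prop)
            exact (by fun_prop : Measurable fun x : E × E =>
              f₁ x.1 * f₂ (x.2 - x.1) * p x.1 (x.2 - x.1) * B (-x.2)).aemeasurable
  rw [key]
  refine (sq_lintegral_mul_le μ hAm.aemeasurable (by fun_prop)).trans ?_
  have hneg : ∫⁻ S, B (-S) ^ 2 ∂μ = ∫⁻ S, B S ^ 2 ∂μ :=
    lintegral_neg_eq_self (fun S => B S ^ 2)
  rw [hneg]
  exact mul_le_mul' (lintegral_sq_weighted_conv_le μ h₁ h₂ hp hK)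
    (lintegral_sq_weighted_conv_le μ h₃ h₄ hq hL)

end Quadrilinear

section Bracket

theorem lintegral_bracket_mul_rpow_lt_top {q : ℝ} (hq : 1 / 2 < q) :
    ∫⁻ x : ℝ, ENNReal.ofReal ((1 + |x|) ^ (-q) * |x| ^ (-(1 / 2) : ℝ)) < ∞ := by
  have h1 : IntegrableOn (fun x : ℝ => |x| ^ (-(1 / 2) : ℝ)) (Set.Icc (-1) 1) := by
    have h0 : IntegrableOn (fun x : ℝ => x ^ (-(1 / 2) : ℝ)) (Set.Icc 0 1) := by
      rw [integrableOn_Icc_iff_integrableOn_Ioc,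
        ← intervalIntegrable_iff_integrableOn_Ioc_of_le zero_le_one]
      exact intervalIntegral.intervalIntegrable_rpow' (by norm_num)
    have hpos : IntegrableOn (fun x : ℝ => |x| ^ (-(1 / 2) : ℝ)) (Set.Icc 0 1) :=
      h0.congr_fun (fun x hx => by simp only [abs_of_nonneg hx.1]) measurableSet_Icc
    have hneg : IntegrableOn (fun x : ℝ => |x| ^ (-(1 / 2) : ℝ)) (Set.Icc (-1) 0) := by
      have := hpos.comp_neg
      simpa using this
    have := hneg.union hpos
    rwa [Set.Icc_union_Icc_eq_Icc (by norm_num) (by norm_num)] at this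
  have h2 : Integrable fun x : ℝ => (2 : ℝ) ^ (1 / 2 : ℝ) * (1 + ‖x‖) ^ (-(q + 1 / 2)) :=
    (integrable_one_add_norm (by simp; linarith)).const_mul _
  refine Integrable.lintegral_lt_top (f := fun x : ℝ => (1 + |x|) ^ (-q) * |x| ^ (-(1 / 2) : ℝ)) ?_
  refine ((h1.integrable_indicator measurableSet_Icc).add h2).mono'
    (by fun_prop) (Filter.Eventually.of_forall fun x => ?_)
  have hx0 : 0 ≤ |x| := abs_nonneg x
  have hA : 0 ≤ |x| ^ (-(1 / 2) : ℝ) := by positivity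
  have hB : 0 ≤ (2 : ℝ) ^ (1 / 2 : ℝ) * (1 + |x|) ^ (-(q + 1 / 2)) := by positivity
  rw [Real.norm_of_nonneg (by positivity)]
  simp only [Pi.add_apply, Real.norm_eq_abs]
  by_cases hx : x ∈ Set.Icc (-1 : ℝ) 1
  · rw [Set.indicator_of_mem hx]
    have : (1 + |x|) ^ (-q) ≤ 1 :=
      Real.rpow_le_one_of_one_le_of_nonpos (by linarith) (by linarith)
    nlinarith [mul_le_mul_of_nonneg_right this hA]
  · rw [Set.indicator_of_notMem hx, zero_add]
    have hx1 : 1 < |x| := by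
      by_contra! h
      exact hx (abs_le.mp h)
    have h3 : |x| ^ (-(1 / 2) : ℝ) ≤ ((1 + |x|) / 2) ^ (-(1 / 2) : ℝ) :=
      Real.rpow_le_rpow_of_nonpos (by linarith) (by linarith) (by norm_num)
    calc (1 + |x|) ^ (-q) * |x| ^ (-(1 / 2) : ℝ)
        ≤ (1 + |x|) ^ (-q) * ((1 + |x|) / 2) ^ (-(1 / 2) : ℝ) := by gcongr
      _ = _ := by
        rw [Real.div_rpow (by linarith) (by norm_num), neg_add, Real.rpow_add (by linarith),
          Real.rpow_neg (x := 2) (by norm_num)]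
        field_simp

theorem exists_lintegral_bracket_mul_rpow_le {q : ℝ} (hq : 1 / 2 < q) :
    ∃ C : ℝ≥0∞, C < ∞ ∧ ∀ c m : ℝ,
      ∫⁻ y : ℝ, ENNReal.ofReal ((1 + |c - y|) ^ (-q) * |y - m| ^ (-(1 / 2) : ℝ)) ≤ C := by
  set I := ∫⁻ x : ℝ, ENNReal.ofReal ((1 + |x|) ^ (-q) * |x| ^ (-(1 / 2) : ℝ))
  have hIt := lintegral_bracket_mul_rpow_lt_top hq
  refine ⟨I + I, ENNReal.add_lt_top.2 ⟨hIt, hIt⟩, fun c m => ?_⟩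
  set φ : ℝ → ℝ≥0∞ := fun x => ENNReal.ofReal ((1 + |x|) ^ (-q) * |x| ^ (-(1 / 2) : ℝ))
  have hφm : Measurable φ := by fun_prop
  calc _ ≤ ∫⁻ y : ℝ, (φ (y - c) + φ (y - m)) := by
        refine lintegral_mono_ae ?_
        filter_upwards [Measure.ae_ne volume c, Measure.ae_ne volume m] with y hyc hym
        rcases le_total |y - c| |y - m| with h | h
        · refine le_trans (ENNReal.ofReal_le_ofReal ?_) le_self_add
          rw [abs_sub_comm c y]
          have : 0 < |y - c| := abs_pos.2 (sub_ne_zero.2 hyc)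
          gcongr ?_ * ?_
          exact Real.rpow_le_rpow_of_nonpos this h (by norm_num)
        · refine le_trans (ENNReal.ofReal_le_ofReal ?_) le_add_self
          rw [abs_sub_comm c y]
          gcongr ?_ * ?_
          exact Real.rpow_le_rpow_of_nonpos (by positivity) (by linarith) (by linarith)
    _ = I + I := by
        rw [lintegral_add_left (by fun_prop), lintegral_sub_right_eq_self φ,
          lintegral_sub_right_eq_self φ]

end Bracket

section Angular

theorem sqrt_law_of_cosines_bounds {ρ r α : ℝ} (hρ : 0 < ρ) (hr : 0 < r) (hα : α ∈ Set.Ioo 0 π) :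
    |ρ - r| < √(ρ ^ 2 + r ^ 2 - 2 * ρ * r * cos α) ∧
      √(ρ ^ 2 + r ^ 2 - 2 * ρ * r * cos α) < ρ + r := by
  have hs := sin_pos_of_mem_Ioo hα
  have h1 : cos α < 1 := by nlinarith [sin_sq_add_cos_sq α, neg_one_le_cos α, cos_le_one α]
  have h2 : -1 < cos α := by nlinarith [sin_sq_add_cos_sq α, neg_one_le_cos α, cos_le_one α]
  have hρr := mul_pos hρ hr
  constructor
  · rw [← sqrt_sq_eq_abs]
    exact sqrt_lt_sqrt (sq_nonneg _) (by nlinarith)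
  · rw [sqrt_lt' (by positivity)]
    nlinarith

/-- The Jacobian of the change of variables from the angle to the opposite side of a triangle
degenerates at most like a square root at the two endpoints. -/
theorem one_le_deriv_law_of_cosines {ρ r α : ℝ} (hρ : 0 < ρ) (hr : 0 < r)
    (hα : α ∈ Set.Ioo 0 π) :
    1 ≤ ρ * r * sin α / √(ρ ^ 2 + r ^ 2 - 2 * ρ * r * cos α) *
      (√2 * (min r ρ) ^ (-(1 / 2) : ℝ) *
        (abs (√(ρ ^ 2 + r ^ 2 - 2 * ρ * r * cos α) - |ρ - r|) ^ (-(1 / 2) : ℝ) +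
          |√(ρ ^ 2 + r ^ 2 - 2 * ρ * r * cos α) - (ρ + r)| ^ (-(1 / 2) : ℝ))) := by
  obtain ⟨hm, hM⟩ := sqrt_law_of_cosines_bounds hρ hr hα
  have hs := sin_pos_of_mem_Ioo hα
  have hnn : 0 ≤ ρ ^ 2 + r ^ 2 - 2 * ρ * r * cos α := by
    nlinarith [sq_nonneg (ρ - r), mul_pos hρ hr, cos_le_one α]
  have hysq := Real.sq_sqrt hnn
  set y := √(ρ ^ 2 + r ^ 2 - 2 * ρ * r * cos α)
  have hy0 : 0 < y := (abs_nonneg _).trans_lt hm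
  set m := |ρ - r| with hmdef
  have hm0 : 0 ≤ m := abs_nonneg _
  have hmsq : m ^ 2 = (ρ - r) ^ 2 := sq_abs _
  rw [abs_of_pos (sub_pos.2 hm), abs_of_neg (sub_neg.2 hM), neg_sub]
  set a := y - m with ha
  set b := ρ + r - y with hb
  have ha0 : 0 < a := sub_pos.2 hm
  have hb0 : 0 < b := sub_pos.2 hM
  set μ := min r ρ with hμ
  have hμ0 : 0 < μ := lt_min hr hρ
  have hab : a + b = 2 * μ := by
    rcases le_total r ρ with h | h
    · rw [ha, hb, hmdef, hμ, abs_of_nonneg (by linarith), min_eq_left h]; ring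
    · rw [ha, hb, hmdef, hμ, abs_of_nonpos (by linarith), min_eq_right h]; ring
  have hd : √(a * b) / √2 ≤ ρ * r * sin α / y := by
    rw [← sqrt_div' _ (by norm_num), sqrt_le_left (by positivity), div_pow,
      le_div_iff₀ (by positivity)]
    have hid : 4 * (ρ * r * sin α) ^ 2 = (a * b) * ((y + m) * (ρ + r + y)) := by
      have : (a * b) * ((y + m) * (ρ + r + y)) = (y ^ 2 - m ^ 2) * ((ρ + r) ^ 2 - y ^ 2) := by
        rw [ha, hb]; ring
      rw [this, hmsq, hysq]
      have := sin_sq α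
      rw [mul_pow, this]; ring
    have h2 : 2 * y ^ 2 ≤ (y + m) * (ρ + r + y) := by nlinarith
    nlinarith [mul_le_mul_of_nonneg_left h2 (mul_pos ha0 hb0).le]
  have hk : √2 / √(a * b) ≤ √2 * μ ^ (-(1 / 2) : ℝ) *
      (a ^ (-(1 / 2) : ℝ) + b ^ (-(1 / 2) : ℝ)) := by
    rw [mul_assoc, div_eq_mul_inv]
    gcongr
    rw [sqrt_eq_rpow, ← rpow_neg (by positivity), mul_rpow ha0.le hb0.le]
    have hA : 0 < a ^ (-(1 / 2) : ℝ) := by positivity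
    have hB : 0 < b ^ (-(1 / 2) : ℝ) := by positivity
    have hU : 0 < μ ^ (-(1 / 2) : ℝ) := by positivity
    rcases le_total a μ with h | h
    · have : b ^ (-(1 / 2) : ℝ) ≤ μ ^ (-(1 / 2) : ℝ) :=
        rpow_le_rpow_of_nonpos hμ0 (by linarith) (by norm_num)
      nlinarith [mul_le_mul_of_nonneg_left this hA.le, mul_pos hU hB]
    · have : a ^ (-(1 / 2) : ℝ) ≤ μ ^ (-(1 / 2) : ℝ) :=
        rpow_le_rpow_of_nonpos hμ0 (by linarith) (by norm_num)
      nlinarith [mul_le_mul_of_nonneg_right this hB.le, mul_pos hU hA]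
  have hsab : 0 < √(a * b) := sqrt_pos.2 (mul_pos ha0 hb0)
  calc (1 : ℝ) = √(a * b) / √2 * (√2 / √(a * b)) := by
        field_simp
    _ ≤ _ := mul_le_mul hd hk (by positivity) (by positivity)

theorem exists_lintegral_angle_le {q : ℝ} (hq : 1 / 2 < q) :
    ∃ C : ℝ≥0∞, C < ∞ ∧ ∀ ρ r c : ℝ, 0 < ρ → 0 < r →
      ∫⁻ α in Set.Ioo 0 π,
        ENNReal.ofReal ((1 + |c - √(ρ ^ 2 + r ^ 2 - 2 * ρ * r * cos α)|) ^ (-q)) ≤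
          C * ENNReal.ofReal ((min r ρ) ^ (-(1 / 2) : ℝ)) := by
  obtain ⟨C, hC, hle⟩ := exists_lintegral_bracket_mul_rpow_le hq
  refine ⟨ENNReal.ofReal (√2) * (C + C), ENNReal.mul_lt_top ENNReal.ofReal_lt_top
    (ENNReal.add_lt_top.2 ⟨hC, hC⟩), fun ρ r c hρ hr => ?_⟩
  set y : ℝ → ℝ := fun α => √(ρ ^ 2 + r ^ 2 - 2 * ρ * r * cos α) with hy
  set k := √2 * (min r ρ) ^ (-(1 / 2) : ℝ) with hk
  have hk0 : 0 ≤ k := by positivity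
  set g : ℝ → ℝ≥0∞ := fun t => ENNReal.ofReal k *
    (ENNReal.ofReal ((1 + |c - t|) ^ (-q) * abs (t - |ρ - r|) ^ (-(1 / 2) : ℝ)) +
      ENNReal.ofReal ((1 + |c - t|) ^ (-q) * |t - (ρ + r)| ^ (-(1 / 2) : ℝ))) with hg
  have hpos : ∀ α ∈ Set.Ioo 0 π, 0 < ρ ^ 2 + r ^ 2 - 2 * ρ * r * cos α := fun α hα =>
    sqrt_pos.1 ((abs_nonneg _).trans_lt (sqrt_law_of_cosines_bounds hρ hr hα).1)
  have hderiv : ∀ α ∈ Set.Ioo 0 π,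
      HasDerivWithinAt y (ρ * r * sin α / y α) (Set.Ioo 0 π) α := fun α hα => by
    have h := (((hasDerivAt_cos α).const_mul (2 * ρ * r)).const_sub (ρ ^ 2 + r ^ 2)).sqrt
      (hpos α hα).ne'
    refine (h.congr_deriv ?_).hasDerivWithinAt
    have := sqrt_pos.2 (hpos α hα)
    simp only [hy]
    field_simp
  have hinj : Set.InjOn y (Set.Ioo 0 π) := fun α hα β hβ h => by
    have h' := (sqrt_inj (hpos α hα).le (hpos β hβ).le).1 h
    have hρr := mul_pos hρ hr
    have hc : cos α = cos β := by
      have : ρ * r * (cos α - cos β) = 0 := by linarith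
      rcases mul_eq_zero.1 this with h | h
      · exact absurd h hρr.ne'
      · linarith
    exact injOn_cos ⟨hα.1.le, hα.2.le⟩ ⟨hβ.1.le, hβ.2.le⟩ hc
  calc ∫⁻ α in Set.Ioo 0 π, ENNReal.ofReal ((1 + |c - y α|) ^ (-q))
      ≤ ∫⁻ α in Set.Ioo 0 π, ENNReal.ofReal |ρ * r * sin α / y α| * g (y α) := by
        refine setLIntegral_mono' measurableSet_Ioo fun α hα => ?_
        have h1 := one_le_deriv_law_of_cosines hρ hr hα
        have hd : 0 ≤ ρ * r * sin α / y α := by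
          have := sin_pos_of_mem_Ioo hα
          positivity
        simp only [hg]
        rw [← ENNReal.ofReal_add (by positivity) (by positivity), ← ENNReal.ofReal_mul hk0,
          ← ENNReal.ofReal_mul (abs_nonneg _), abs_of_nonneg hd]
        refine ENNReal.ofReal_le_ofReal ?_
        have hB : 0 ≤ (1 + |c - y α|) ^ (-q) := by positivity
        calc (1 + |c - y α|) ^ (-q) = 1 * (1 + |c - y α|) ^ (-q) := (one_mul _).symm
          _ ≤ _ := mul_le_mul_of_nonneg_right h1 hB
          _ = _ := by simp only [hk, hy]; ring
    _ = ∫⁻ t in y '' Set.Ioo 0 π, g t :=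
        (lintegral_image_eq_lintegral_abs_deriv_mul measurableSet_Ioo hderiv hinj g).symm
    _ ≤ ∫⁻ t, g t := setLIntegral_le_lintegral _ _
    _ ≤ ENNReal.ofReal k * (C + C) := by
        rw [hg, lintegral_const_mul _ (by fun_prop), lintegral_add_left (by fun_prop)]
        gcongr
        · exact hle _ _
        · exact hle _ _
    _ = _ := by
        rw [hk, ENNReal.ofReal_mul (by positivity)]
        ring

end Angular

section Planar

theorem norm_sub_polar (ρ r α : ℝ) :
    ‖(ρ : ℂ) - r * (Real.cos α + Real.sin α * Complex.I)‖ =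
      √(ρ ^ 2 + r ^ 2 - 2 * ρ * r * Real.cos α) := by
  rw [Complex.norm_def, Complex.normSq_apply]
  congr 1
  simp [-Complex.ofReal_cos, -Complex.ofReal_sin]
  linear_combination r ^ 2 * Real.sin_sq_add_cos_sq α

theorem setLIntegral_Ioo_neg_le {f : ℝ → ℝ≥0∞} (hf : ∀ x, f (-x) = f x) (a : ℝ) :
    ∫⁻ x in Set.Ioo (-a) a, f x ≤ 2 * ∫⁻ x in Set.Ioo 0 a, f x := by
  have hneg : ∫⁻ x in Set.Ioo (-a) 0, f x = ∫⁻ x in Set.Ioo 0 a, f x := by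
    rw [← lintegral_indicator measurableSet_Ioo, ← lintegral_indicator measurableSet_Ioo,
      ← lintegral_neg_eq_self]
    refine lintegral_congr fun x => ?_
    simp only [Set.indicator, Set.mem_Ioo, hf]
    congr 1
    simp [and_comm]
  calc ∫⁻ x in Set.Ioo (-a) a, f x
      ≤ ∫⁻ x in Set.Ioc (-a) 0 ∪ Set.Ioo 0 a, f x := by
        refine lintegral_mono_set fun x hx => ?_
        rcases le_or_gt x 0 with h | h
        · exact Or.inl ⟨hx.1, h⟩
        · exact Or.inr ⟨h, hx.2⟩
    _ ≤ (∫⁻ x in Set.Ioc (-a) 0, f x) + ∫⁻ x in Set.Ioo 0 a, f x := lintegral_union_le _ _ _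
    _ = _ := by rw [← setLIntegral_congr Ioo_ae_eq_Ioc, hneg, two_mul]

theorem exists_lintegral_planar_le {q σ K : ℝ} (hq : 1 / 2 < q) (hσ : 3 / 4 < σ) (hK : 1 ≤ K) :
    ∃ C : ℝ≥0∞, C < ∞ ∧ ∀ (η : ℂ) (c : ℝ → ℝ), Measurable c →
      ∫⁻ ξ : ℂ, (if ‖ξ‖ ≤ K * ‖η‖ then
        ENNReal.ofReal ((1 + ‖ξ‖ ^ 2) ^ (-σ) * (1 + |c ‖ξ‖ - ‖η - ξ‖|) ^ (-q)) else 0) ≤ C := by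
  obtain ⟨C, hC, hle⟩ := exists_lintegral_angle_le hq
  have hint : ∫⁻ r : ℝ, ENNReal.ofReal ((1 + ‖r‖ ^ 2) ^ (-(2 * σ - 1 / 2) / 2)) < ∞ :=
    (integrable_rpow_neg_one_add_norm_sq (by simp; linarith)).lintegral_lt_top
  refine ⟨∫⁻ r : ℝ, 2 * C * ENNReal.ofReal (K ^ (1 / 2 : ℝ)) *
    ENNReal.ofReal ((1 + ‖r‖ ^ 2) ^ (-(2 * σ - 1 / 2) / 2)), ?_, fun η c hc => ?_⟩
  · rw [lintegral_const_mul _ (by fun_prop)]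
    exact ENNReal.mul_lt_top (ENNReal.mul_lt_top (ENNReal.mul_lt_top (by simp) hC)
      ENNReal.ofReal_lt_top) hint
  set ρ := ‖η‖
  obtain ⟨u, hu⟩ : ∃ u : Circle, η = u * (ρ : ℂ) := by
    refine ⟨Circle.exp η.arg, ?_⟩
    rw [Circle.coe_exp, mul_comm]
    exact (Complex.norm_mul_exp_arg_mul_I η).symm
  set G : ℂ → ℝ≥0∞ := fun ξ => if ‖ξ‖ ≤ K * ρ then
    ENNReal.ofReal ((1 + ‖ξ‖ ^ 2) ^ (-σ) * (1 + |c ‖ξ‖ - ‖(ρ : ℂ) - ξ‖|) ^ (-q)) else 0 with hG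
  have hGm : Measurable G := Measurable.ite (measurableSet_le (by fun_prop) (by fun_prop))
    (by fun_prop) measurable_const
  have hrot : ∫⁻ ξ : ℂ, (if ‖ξ‖ ≤ K * ρ then
        ENNReal.ofReal ((1 + ‖ξ‖ ^ 2) ^ (-σ) * (1 + |c ‖ξ‖ - ‖η - ξ‖|) ^ (-q)) else 0) =
      ∫⁻ ξ, G ξ := by
    rw [← (rotation u).measurePreserving.lintegral_comp_emb
      (rotation u).toHomeomorph.measurableEmbedding]
    refine lintegral_congr fun ξ => ?_
    have : ‖η - rotation u ξ‖ = ‖(ρ : ℂ) - ξ‖ := by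
      rw [rotation_apply, hu, ← mul_sub, norm_mul, Circle.norm_coe, one_mul]
    simp only [this, LinearIsometryEquiv.norm_map, hG]
  rw [hrot, ← Complex.lintegral_comp_polarCoord_symm]
  change ∫⁻ p in Set.Ioi (0 : ℝ) ×ˢ Set.Ioo (-π) π, _ ≤ _
  rw [Measure.volume_eq_prod, ← Measure.prod_restrict, lintegral_prod]
  swap
  · refine Measurable.aemeasurable ?_
    have h2 : Measurable fun p : ℝ × ℝ => Complex.polarCoord.symm p := by
      simp only [Complex.polarCoord_symm_apply]
      fun_prop
    exact (by fun_prop : Measurable fun p : ℝ × ℝ => ENNReal.ofReal p.1).smul (hGm.comp h2)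
  refine (setLIntegral_mono' measurableSet_Ioi fun r hr => ?_).trans (setLIntegral_le_lintegral _ _)
  have hr0 : 0 < r := hr
  simp only [Complex.polarCoord_symm_apply, hG, norm_sub_polar, smul_eq_mul]
  have hnorm : ∀ α : ℝ, ‖(r : ℂ) * (Real.cos α + Real.sin α * Complex.I)‖ = r := fun α => by
    have := Complex.norm_polarCoord_symm (r, α)
    rwa [Complex.polarCoord_symm_apply, abs_of_pos hr0] at this
  simp only [hnorm]
  split_ifs with hrK
  swap
  · simp
  have hρ0 : 0 < ρ := by
    by_contra! h
    nlinarith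
  calc ∫⁻ α in Set.Ioo (-π) π, ENNReal.ofReal r * ENNReal.ofReal ((1 + r ^ 2) ^ (-σ) *
          (1 + |c r - √(ρ ^ 2 + r ^ 2 - 2 * ρ * r * Real.cos α)|) ^ (-q))
      = ENNReal.ofReal (r * (1 + r ^ 2) ^ (-σ)) * ∫⁻ α in Set.Ioo (-π) π, ENNReal.ofReal
          ((1 + |c r - √(ρ ^ 2 + r ^ 2 - 2 * ρ * r * Real.cos α)|) ^ (-q)) := by
        rw [← lintegral_const_mul _ (by fun_prop)]
        refine lintegral_congr fun α => ?_
        rw [← ENNReal.ofReal_mul hr0.le, ← ENNReal.ofReal_mul (by positivity)]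
        congr 1
        ring
    _ ≤ ENNReal.ofReal (r * (1 + r ^ 2) ^ (-σ)) *
          (2 * (C * ENNReal.ofReal ((min r ρ) ^ (-(1 / 2) : ℝ)))) := by
        gcongr
        refine (setLIntegral_Ioo_neg_le (fun α => by rw [Real.cos_neg]) π).trans ?_
        gcongr
        exact hle ρ r (c r) hρ0 hr0
    _ = 2 * C * ENNReal.ofReal (r * (1 + r ^ 2) ^ (-σ) * (min r ρ) ^ (-(1 / 2) : ℝ)) := by
        rw [ENNReal.ofReal_mul (p := r * (1 + r ^ 2) ^ (-σ)) (by positivity)]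
        ring
    _ ≤ 2 * C * ENNReal.ofReal (K ^ (1 / 2 : ℝ) * (1 + ‖r‖ ^ 2) ^ (-(2 * σ - 1 / 2) / 2)) := by
        gcongr 2 * C * ENNReal.ofReal ?_
        have hmin : r / K ≤ min r ρ := by
          refine le_min (div_le_self hr0.le hK) ?_
          rw [div_le_iff₀ (by linarith)]
          linarith
        have h1 : (min r ρ) ^ (-(1 / 2) : ℝ) ≤ (r / K) ^ (-(1 / 2) : ℝ) :=
          rpow_le_rpow_of_nonpos (by positivity) hmin (by norm_num)
        have h2 : (r / K) ^ (-(1 / 2) : ℝ) = K ^ (1 / 2 : ℝ) * r ^ (-(1 / 2) : ℝ) := by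
          rw [div_rpow hr0.le (by linarith), rpow_neg (x := K) (by linarith)]
          field_simp
        have h3 : r * r ^ (-(1 / 2) : ℝ) ≤ (1 + r ^ 2) ^ (1 / 4 : ℝ) := by
          have e1 : r * r ^ (-(1 / 2) : ℝ) = (r ^ 2) ^ (1 / 4 : ℝ) := by
            rw [← rpow_natCast, ← rpow_mul hr0.le]
            nth_rewrite 1 [← rpow_one r]
            rw [← rpow_add hr0]
            norm_num
          rw [e1]
          gcongr
          linarith
        calc r * (1 + r ^ 2) ^ (-σ) * (min r ρ) ^ (-(1 / 2) : ℝ)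
            ≤ r * (1 + r ^ 2) ^ (-σ) * (K ^ (1 / 2 : ℝ) * r ^ (-(1 / 2) : ℝ)) := by
              rw [← h2]; gcongr
          _ = K ^ (1 / 2 : ℝ) * ((r * r ^ (-(1 / 2) : ℝ)) * (1 + r ^ 2) ^ (-σ)) := by ring
          _ ≤ K ^ (1 / 2 : ℝ) * ((1 + r ^ 2) ^ (1 / 4 : ℝ) * (1 + r ^ 2) ^ (-σ)) := by gcongr
          _ = _ := by
              rw [← rpow_add (by positivity), Real.norm_of_nonneg hr0.le]
              ring_nf
    _ = _ := by
        rw [ENNReal.ofReal_mul (by positivity)]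
        ring

end Planar

section Cone

/-- The weight that localises to frequencies of size at most twice that of the output. -/
def lowWeight (σ : ℝ) (n m : ℝ) : ℝ≥0∞ :=
  if n ≤ 2 * m then ENNReal.ofReal ((1 + n ^ 2) ^ (-σ)) else 0

theorem measurable_lowWeight {α : Type*} [MeasurableSpace α] (σ : ℝ) {f g : α → ℝ}
    (hf : Measurable f) (hg : Measurable g) : Measurable fun x => lowWeight σ (f x) (g x) :=
  Measurable.ite (measurableSet_le hf (by fun_prop)) (by fun_prop) measurable_const

theorem lowWeight_min_le (σ a b m : ℝ) :
    lowWeight σ (min a b) m ≤ lowWeight σ a m + lowWeight σ b m := by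
  rcases min_choice a b with h | h <;> rw [h]
  exacts [le_self_add, le_add_self]

theorem exists_lintegral_resonance_le {q σ : ℝ} (hq : 1 / 2 < q) (hσ : 3 / 4 < σ) :
    ∃ C : ℝ≥0∞, C < ∞ ∧ ∀ (η : ℂ) (t s s' : ℝ), |s| = 1 → |s'| = 1 →
      ∫⁻ ξ : ℂ, ENNReal.ofReal ((1 + |t - s * ‖ξ‖ - s' * ‖η - ξ‖|) ^ (-q)) *
        lowWeight σ (min ‖ξ‖ ‖η - ξ‖) ‖η‖ ≤ C := by
  obtain ⟨C, hC, hle⟩ := exists_lintegral_planar_le hq hσ one_le_two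
  refine ⟨C + C, ENNReal.add_lt_top.2 ⟨hC, hC⟩, fun η t s s' hs hs' => ?_⟩
  have hsign : ∀ {s : ℝ}, |s| = 1 → ∀ x y : ℝ, |x - s * y| = |s * x - y| := fun {s} hs x y => by
    rcases eq_or_eq_neg_of_abs_eq hs with rfl | rfl
    · simp
    · rw [← abs_neg]; congr 1; ring
  have hlow : ∀ s s' : ℝ, |s'| = 1 → ∫⁻ ξ : ℂ,
      ENNReal.ofReal ((1 + |t - s * ‖ξ‖ - s' * ‖η - ξ‖|) ^ (-q)) * lowWeight σ ‖ξ‖ ‖η‖ ≤ C := by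
    intro s s' hs'
    refine le_trans (le_of_eq (lintegral_congr fun ξ => ?_))
      (hle η (fun r => s' * (t - s * r)) (by fun_prop))
    rw [lowWeight, hsign hs']
    split_ifs
    · rw [← ENNReal.ofReal_mul (by positivity), mul_comm]
    · simp
  have hm : ∀ s s' : ℝ, Measurable fun ξ : ℂ =>
      ENNReal.ofReal ((1 + |t - s * ‖ξ‖ - s' * ‖η - ξ‖|) ^ (-q)) * lowWeight σ ‖ξ‖ ‖η‖ :=
    fun s s' => (by fun_prop : Measurable fun ξ : ℂ =>
      ENNReal.ofReal ((1 + |t - s * ‖ξ‖ - s' * ‖η - ξ‖|) ^ (-q))).mul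
        (measurable_lowWeight σ (by fun_prop) (by fun_prop))
  calc _ ≤ ∫⁻ ξ : ℂ,
        (ENNReal.ofReal ((1 + |t - s * ‖ξ‖ - s' * ‖η - ξ‖|) ^ (-q)) * lowWeight σ ‖ξ‖ ‖η‖ +
        ENNReal.ofReal ((1 + |t - s * ‖ξ‖ - s' * ‖η - ξ‖|) ^ (-q)) *
          lowWeight σ ‖η - ξ‖ ‖η‖) := by
        refine lintegral_mono fun ξ => ?_
        rw [← mul_add]
        gcongr
        exact lowWeight_min_le _ _ _ _
    _ ≤ C + C := by
        rw [lintegral_add_left (hm s s')]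
        gcongr
        · exact hlow s s' hs'
        · rw [← lintegral_sub_left_eq_self _ η]
          refine le_trans (le_of_eq (lintegral_congr fun ξ => ?_)) (hlow s' s hs)
          rw [sub_sub_cancel, sub_right_comm]

theorem ofReal_bracket_abs_le (p x r : ℝ) :
    ENNReal.ofReal ((1 + |(|x| - r)|) ^ (-p)) ≤
      ∑ s ∈ ({1, -1} : Finset ℝ), ENNReal.ofReal ((1 + |x - s * r|) ^ (-p)) := by
  rw [Finset.sum_pair (by norm_num)]
  rcases le_total 0 x with h | h
  · rw [abs_of_nonneg h, one_mul]
    exact le_self_add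
  · rw [abs_of_nonpos h, ← abs_neg, neg_sub, sub_neg_eq_add, neg_one_mul, sub_neg_eq_add,
      add_comm r x]
    exact le_add_self

theorem lintegral_lintegral_finsetSum {ι α β : Type*} [MeasurableSpace α] [MeasurableSpace β]
    {μ : Measure α} {ν : Measure β} [SFinite ν] (S : Finset ι) {F : ι → α → β → ℝ≥0∞}
    (hF : ∀ i, Measurable (Function.uncurry (F i))) :
    ∫⁻ x, ∫⁻ y, ∑ i ∈ S, F i x y ∂ν ∂μ = ∑ i ∈ S, ∫⁻ x, ∫⁻ y, F i x y ∂ν ∂μ := by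
  have h (x) : ∫⁻ y, ∑ i ∈ S, F i x y ∂ν = ∑ i ∈ S, ∫⁻ y, F i x y ∂ν :=
    lintegral_finsetSum _ fun i _ => (hF i).comp measurable_prodMk_left
  simp only [h]
  exact lintegral_finsetSum _ fun i _ => (hF i).lintegral_prod_right'

/-- The phase-space weight attached to a choice of the signs of the two modulations. -/
def coneWeight (p q σ t : ℝ) (η : ℂ) (s s' : ℝ) (ξ : ℂ) (τ : ℝ) : ℝ≥0∞ :=
  ENNReal.ofReal ((1 + |τ - s * ‖ξ‖|) ^ (-p)) *
    (ENNReal.ofReal ((1 + |t - τ - s' * ‖η - ξ‖|) ^ (-q)) *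
      lowWeight σ (min ‖ξ‖ ‖η - ξ‖) ‖η‖)

theorem measurable_coneWeight (p q σ t : ℝ) (η : ℂ) (s s' : ℝ) :
    Measurable (Function.uncurry (coneWeight p q σ t η s s')) :=
  (by fun_prop : Measurable fun x : ℂ × ℝ =>
    ENNReal.ofReal ((1 + |x.2 - s * ‖x.1‖|) ^ (-p))).mul
    ((by fun_prop : Measurable fun x : ℂ × ℝ =>
      ENNReal.ofReal ((1 + |t - x.2 - s' * ‖η - x.1‖|) ^ (-q))).mul
      (measurable_lowWeight σ (by fun_prop) (by fun_prop)))

theorem exists_lintegral_coneWeight_le {p q σ : ℝ} (hp : 1 < p) (hq : 1 / 2 < q)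
    (hσ : 3 / 4 < σ) :
    ∃ C : ℝ≥0∞, C < ∞ ∧ ∀ (η : ℂ) (t s s' : ℝ), |s| = 1 → |s'| = 1 →
      ∫⁻ ξ : ℂ, ∫⁻ τ : ℝ, coneWeight p q σ t η s s' ξ τ ≤ C := by
  obtain ⟨C, hC, hle⟩ := exists_lintegral_resonance_le hq hσ
  have hint : ∫⁻ x : ℝ, ENNReal.ofReal ((1 + ‖x‖) ^ (-p)) < ∞ :=
    (integrable_one_add_norm (by simpa using hp)).lintegral_lt_top
  refine ⟨_, ENNReal.mul_lt_top hint hC, fun η t s s' hs hs' => ?_⟩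
  have hm : Measurable fun x : ℂ × ℝ => coneWeight p q σ t η s s' x.1 (x.2 + s * ‖x.1‖) :=
    (measurable_coneWeight p q σ t η s s').comp
      (f := fun x : ℂ × ℝ => (x.1, x.2 + s * ‖x.1‖)) (by fun_prop)
  calc ∫⁻ ξ, ∫⁻ τ, coneWeight p q σ t η s s' ξ τ
      = ∫⁻ ξ, ∫⁻ τ, coneWeight p q σ t η s s' ξ (τ + s * ‖ξ‖) :=
        lintegral_congr fun ξ => (lintegral_add_right_eq_self _ _).symm
    _ = ∫⁻ τ, ∫⁻ ξ, coneWeight p q σ t η s s' ξ (τ + s * ‖ξ‖) :=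
        lintegral_lintegral_swap hm.aemeasurable
    _ ≤ ∫⁻ τ, ENNReal.ofReal ((1 + ‖τ‖) ^ (-p)) * C := by
        refine lintegral_mono fun τ => ?_
        simp only [coneWeight, add_sub_cancel_right]
        rw [lintegral_const_mul' _ _ ENNReal.ofReal_ne_top]
        refine mul_le_mul' (by rw [Real.norm_eq_abs]) ?_
        refine le_trans (le_of_eq (lintegral_congr fun ξ => ?_)) (hle η (t - τ) s s' hs hs')
        rw [sub_add_eq_sub_sub]
    _ = _ := lintegral_mul_const _ (by fun_prop)

theorem bracket_mul_le_sum_coneWeight (p q σ t : ℝ) (η ξ : ℂ) (τ : ℝ) :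
    ENNReal.ofReal ((1 + |(|τ| - ‖ξ‖)|) ^ (-p)) *
        ENNReal.ofReal ((1 + |(|t - τ| - ‖η - ξ‖)|) ^ (-q)) *
          lowWeight σ (min ‖ξ‖ ‖η - ξ‖) ‖η‖ ≤
      ∑ s ∈ ({1, -1} : Finset ℝ), ∑ s' ∈ ({1, -1} : Finset ℝ), coneWeight p q σ t η s s' ξ τ := by
  refine (mul_le_mul_left (mul_le_mul' (ofReal_bracket_abs_le p τ ‖ξ‖)
    (ofReal_bracket_abs_le q (t - τ) ‖η - ξ‖)) _).trans (le_of_eq ?_)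
  rw [Finset.sum_mul_sum, Finset.sum_mul]
  refine Finset.sum_congr rfl fun s _ => ?_
  rw [Finset.sum_mul]
  exact Finset.sum_congr rfl fun s' _ => mul_assoc _ _ _

/-- The square of the kernel governing the product of two wave-Sobolev functions has bounded
integral over each fibre of the addition map. -/
theorem exists_lintegral_cone_le {p q σ : ℝ} (hp : 1 < p) (hq : 1 / 2 < q) (hσ : 3 / 4 < σ) :
    ∃ C : ℝ≥0∞, C < ∞ ∧ ∀ (η : ℂ) (t : ℝ),
      ∫⁻ ξ : ℂ, ∫⁻ τ : ℝ, ENNReal.ofReal ((1 + |(|τ| - ‖ξ‖)|) ^ (-p)) *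
        ENNReal.ofReal ((1 + |(|t - τ| - ‖η - ξ‖)|) ^ (-q)) *
          lowWeight σ (min ‖ξ‖ ‖η - ξ‖) ‖η‖ ≤ C := by
  obtain ⟨C, hC, hle⟩ := exists_lintegral_coneWeight_le hp hq hσ
  have hsign : ∀ s ∈ ({1, -1} : Finset ℝ), |s| = 1 := fun s hs => by
    rcases Finset.mem_insert.1 hs with rfl | h
    · simp
    · rw [Finset.mem_singleton.1 h]; simp
  refine ⟨∑ s ∈ ({1, -1} : Finset ℝ), ∑ s' ∈ ({1, -1} : Finset ℝ), C,
    ENNReal.sum_lt_top.2 fun _ _ => ENNReal.sum_lt_top.2 fun _ _ => hC, fun η t => ?_⟩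
  refine (lintegral_mono fun ξ => lintegral_mono fun τ =>
    bracket_mul_le_sum_coneWeight p q σ t η ξ τ).trans ?_
  generalize ({1, -1} : Finset ℝ) = S at hsign
  simp only [← Finset.sum_product']
  rw [lintegral_lintegral_finsetSum (S ×ˢ S)
    fun i => measurable_coneWeight p q σ t η i.1 i.2]
  refine Finset.sum_le_sum fun i hi => ?_
  rw [Finset.mem_product] at hi
  exact hle η t i.1 i.2 (hsign _ hi.1) (hsign _ hi.2)

end Cone

section PairKernel

/-- The spatial part of a frequency point, as a complex number. -/
def spComplex (X : SpaceTime) : ℂ := ⟨X 1, X 2⟩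

theorem norm_spComplex (X : SpaceTime) : ‖spComplex X‖ = spFreq X := by
  rw [spFreq, Complex.norm_eq_sqrt_sq_add_sq]; rfl

theorem spComplex_add (X Y : SpaceTime) : spComplex (X + Y) = spComplex X + spComplex Y := rfl

theorem spComplex_sub (X Y : SpaceTime) : spComplex (X - Y) = spComplex X - spComplex Y := rfl

theorem measurable_spFreq : Measurable spFreq := by unfold spFreq; fun_prop

/-- The modulation weight `1 + ||τ| - |ξ||`. -/
def modulation (X : SpaceTime) : ℝ := 1 + |(|X 0| - spFreq X)|

theorem one_le_modulation (X : SpaceTime) : 1 ≤ modulation X :=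
  le_add_of_nonneg_right (abs_nonneg _)

theorem measurable_modulation : Measurable modulation := by
  have := measurable_spFreq
  unfold modulation; fun_prop

theorem measurePreserving_spComplex_time :
    MeasurePreserving fun X : SpaceTime => (spComplex X, X 0) := by
  have h1 := EuclideanSpace.volume_preserving_symm_measurableEquiv_toLp (Fin 3)
  have h2 := volume_preserving_piFinSuccAbove (fun _ : Fin 3 => ℝ) 0
  have h3 := Complex.volume_preserving_equiv_pi.symm.prod
    (MeasurePreserving.id (volume : Measure ℝ))
  have h4 := h3.comp (Measure.measurePreserving_swap.comp (h2.comp h1))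
  convert h4 using 2 with X
  · ext1
    · simpa [spComplex, Complex.ext_iff] using ⟨rfl, rfl⟩
    · rfl
  · rfl

/-- The kernel that controls the product of two wave-Sobolev functions. -/
def pairKernel (σ a b : ℝ) (X Y : SpaceTime) : ℝ≥0∞ :=
  ENNReal.ofReal (modulation X ^ (-a)) * ENNReal.ofReal (modulation Y ^ (-b)) *
    lowWeight σ (min (spFreq X) (spFreq Y)) (spFreq (X + Y))

theorem measurable_pairKernel (σ a b : ℝ) : Measurable (Function.uncurry (pairKernel σ a b)) := by
  have h1 := measurable_modulation
  have h2 := measurable_spFreq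
  exact ((by fun_prop : Measurable fun x : SpaceTime × SpaceTime =>
    ENNReal.ofReal (modulation x.1 ^ (-a)) * ENNReal.ofReal (modulation x.2 ^ (-b)))).mul
    (measurable_lowWeight σ (by fun_prop) (by fun_prop))

theorem ofReal_rpow_neg_sq {x : ℝ} (hx : 0 < x) (a : ℝ) :
    ENNReal.ofReal (x ^ (-a)) ^ 2 = ENNReal.ofReal (x ^ (-(2 * a))) := by
  rw [← ENNReal.ofReal_pow (by positivity), ← rpow_mul_natCast hx.le]
  congr 2; push_cast; ring

theorem pairKernel_sq (σ a b : ℝ) (X Y : SpaceTime) :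
    pairKernel σ a b X Y ^ 2 = pairKernel (2 * σ) (2 * a) (2 * b) X Y := by
  have hX := zero_lt_one.trans_le (one_le_modulation X)
  have hY := zero_lt_one.trans_le (one_le_modulation Y)
  rw [pairKernel, pairKernel, mul_pow, mul_pow, ofReal_rpow_neg_sq hX, ofReal_rpow_neg_sq hY,
    lowWeight, lowWeight]
  congr 1
  split_ifs
  · exact ofReal_rpow_neg_sq (by positivity) σ
  · simp

theorem exists_lintegral_pairKernel_sq_le {σ a b : ℝ} (ha : 1 / 2 < a) (hb : 1 / 4 < b)
    (hσ : 3 / 8 < σ) :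
    ∃ C : ℝ≥0∞, C < ∞ ∧ ∀ S : SpaceTime, ∫⁻ X, pairKernel σ a b X (S - X) ^ 2 ≤ C := by
  obtain ⟨C, hC, hle⟩ := exists_lintegral_cone_le (p := 2 * a) (q := 2 * b) (σ := 2 * σ)
    (by linarith) (by linarith) (by linarith)
  refine ⟨C, hC, fun S => le_trans (le_of_eq ?_) (hle (spComplex S) (S 0))⟩
  set G : ℂ × ℝ → ℝ≥0∞ := fun x => ENNReal.ofReal ((1 + |(|x.2| - ‖x.1‖)|) ^ (-(2 * a))) *
        ENNReal.ofReal ((1 + |(|S 0 - x.2| - ‖spComplex S - x.1‖)|) ^ (-(2 * b))) *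
          lowWeight (2 * σ) (min ‖x.1‖ ‖spComplex S - x.1‖) ‖spComplex S‖ with hG
  have hGm : Measurable G := (by fun_prop : Measurable fun x : ℂ × ℝ =>
      ENNReal.ofReal ((1 + |(|x.2| - ‖x.1‖)|) ^ (-(2 * a))) *
        ENNReal.ofReal ((1 + |(|S 0 - x.2| - ‖spComplex S - x.1‖)|) ^ (-(2 * b)))).mul
      (measurable_lowWeight (2 * σ) (by fun_prop) (by fun_prop))
  calc ∫⁻ X, pairKernel σ a b X (S - X) ^ 2 = ∫⁻ X : SpaceTime, G (spComplex X, X 0) := by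
        refine lintegral_congr fun X => ?_
        rw [pairKernel_sq]
        simp only [pairKernel, modulation, ← norm_spComplex, spComplex_sub, hG,
          add_sub_cancel, PiLp.sub_apply]
    _ = ∫⁻ x, G x := measurePreserving_spComplex_time.lintegral_comp hGm
    _ = _ := lintegral_prod _ hGm.aemeasurable

end PairKernel

section Interaction

theorem linear_nonneg_of_vertices {a c e ν α γ : ℝ} (hα : 0 ≤ α) (hγ : 0 ≤ γ)
    (hαν : α ≤ ν) (hγν : γ ≤ ν) (he : 0 ≤ e) (hae : 0 ≤ a + e) (hce : 0 ≤ c + e)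
    (hace : 0 ≤ a + c + e) : 0 ≤ a * α + c * γ + e * ν := by
  have hν : 0 ≤ ν := hα.trans hαν
  rcases le_total 0 a with ha | ha <;> rcases le_total 0 c with hc | hc
  · positivity
  · nlinarith [mul_nonneg ha hα, mul_le_mul_of_nonpos_left hγν hc, mul_nonneg hce hν]
  · nlinarith [mul_nonneg hc hγ, mul_le_mul_of_nonpos_left hαν ha, mul_nonneg hae hν]
  · nlinarith [mul_le_mul_of_nonpos_left hαν ha, mul_le_mul_of_nonpos_left hγν hc,
      mul_nonneg hace hν]

theorem bracket_rpow_mul_le_of_le {σ a₁ a₂ a₃ a₄ x₁ x₂ x₃ x₄ M : ℝ}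
    (ha₁ : 0 ≤ a₁) (ha₂ : 0 ≤ a₂) (ha₃ : 0 ≤ a₃) (ha₄ : 0 ≤ a₄)
    (h₁₂₄ : σ ≤ a₁ + a₂ + a₄) (h₂₃₄ : σ ≤ a₂ + a₃ + a₄)
    (hall : 2 * σ ≤ a₁ + a₂ + a₃ + a₄) (hx₁ : 0 ≤ x₁) (hx₃ : 0 ≤ x₃)
    (hM₁ : x₁ ≤ M) (hM₃ : x₃ ≤ M) (hM₂ : M / 3 ≤ x₂) (hM₄ : M / 3 ≤ x₄) :
    (1 + x₁ ^ 2) ^ (-a₁) * (1 + x₂ ^ 2) ^ (-a₂) * (1 + x₃ ^ 2) ^ (-a₃) * (1 + x₄ ^ 2) ^ (-a₄) ≤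
      9 ^ (a₁ + a₂ + a₃ + a₄) * ((1 + x₁ ^ 2) ^ (-σ) * (1 + x₃ ^ 2) ^ (-σ)) := by
  have hpos (x : ℝ) : 0 < 1 + x ^ 2 := by positivity
  have hlog {x : ℝ} (hx : M / 3 ≤ x) : log (1 + M ^ 2) ≤ log 9 + log (1 + x ^ 2) := by
    rw [← log_mul (by norm_num) (hpos x).ne']
    exact log_le_log (hpos M) (by nlinarith)
  have hlog' {x : ℝ} (hx : 0 ≤ x) (hxM : x ≤ M) : log (1 + x ^ 2) ≤ log (1 + M ^ 2) :=
    log_le_log (hpos x) (by nlinarith)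
  have hnonneg (x : ℝ) : 0 ≤ log (1 + x ^ 2) := log_nonneg (by nlinarith)
  have key := linear_nonneg_of_vertices (a := a₁ - σ) (c := a₃ - σ) (e := a₂ + a₄)
    (hnonneg x₁) (hnonneg x₃) (hlog' hx₁ hM₁) (hlog' hx₃ hM₃) (by positivity) (by linarith)
    (by linarith) (by linarith)
  have h9 : 0 ≤ log 9 := log_nonneg (by norm_num)
  rw [rpow_def_of_pos (hpos x₁), rpow_def_of_pos (hpos x₂), rpow_def_of_pos (hpos x₃),
    rpow_def_of_pos (hpos x₄), rpow_def_of_pos (hpos x₁), rpow_def_of_pos (hpos x₃),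
    rpow_def_of_pos (by norm_num : (0 : ℝ) < 9), ← exp_add, ← exp_add, ← exp_add, ← exp_add,
    ← exp_add]
  refine exp_le_exp.2 ?_
  nlinarith [mul_le_mul_of_nonneg_left (hlog hM₂) ha₂, mul_le_mul_of_nonneg_left (hlog hM₄) ha₄,
    mul_nonneg h9 ha₁, mul_nonneg h9 ha₃]

/-- Spatial weights of four interacting frequencies, in the case where each of two disjoint pairs
contains a frequency of maximal size. -/
theorem bracket_rpow_mul_le {σ a₁ a₂ a₃ a₄ x₁ x₂ x₃ x₄ M : ℝ}
    (ha₁ : 0 ≤ a₁) (ha₂ : 0 ≤ a₂) (ha₃ : 0 ≤ a₃) (ha₄ : 0 ≤ a₄)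
    (h₁₂₃ : σ ≤ a₁ + a₂ + a₃) (h₁₂₄ : σ ≤ a₁ + a₂ + a₄) (h₁₃₄ : σ ≤ a₁ + a₃ + a₄)
    (h₂₃₄ : σ ≤ a₂ + a₃ + a₄) (hall : 2 * σ ≤ a₁ + a₂ + a₃ + a₄)
    (hx₁ : 0 ≤ x₁) (hx₂ : 0 ≤ x₂) (hx₃ : 0 ≤ x₃) (hx₄ : 0 ≤ x₄)
    (hM₁ : x₁ ≤ M) (hM₂ : x₂ ≤ M) (hM₃ : x₃ ≤ M) (hM₄ : x₄ ≤ M)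
    (hM₁₂ : M / 3 ≤ max x₁ x₂) (hM₃₄ : M / 3 ≤ max x₃ x₄) :
    (1 + x₁ ^ 2) ^ (-a₁) * (1 + x₂ ^ 2) ^ (-a₂) * (1 + x₃ ^ 2) ^ (-a₃) * (1 + x₄ ^ 2) ^ (-a₄) ≤
      9 ^ (a₁ + a₂ + a₃ + a₄) *
        ((1 + min x₁ x₂ ^ 2) ^ (-σ) * (1 + min x₃ x₄ ^ 2) ^ (-σ)) := by
  rcases le_total x₁ x₂ with h | h <;> rcases le_total x₃ x₄ with h' | h' <;>
    simp only [h, h', max_eq_left, max_eq_right, min_eq_left, min_eq_right] at hM₁₂ hM₃₄ ⊢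
  · exact bracket_rpow_mul_le_of_le ha₁ ha₂ ha₃ ha₄ (by linarith) (by linarith) (by linarith)
      hx₁ hx₃ hM₁ hM₃ hM₁₂ hM₃₄
  · convert bracket_rpow_mul_le_of_le (σ := σ) ha₁ ha₂ ha₄ ha₃ (by linarith) (by linarith)
      (by linarith) hx₁ hx₄ hM₁ hM₄ hM₁₂ hM₃₄ using 1
    · ring
    · congr 2; ring
  · convert bracket_rpow_mul_le_of_le (σ := σ) ha₂ ha₁ ha₃ ha₄ (by linarith) (by linarith)
      (by linarith) hx₂ hx₃ hM₂ hM₃ hM₁₂ hM₃₄ using 1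
    · ring
    · congr 2; ring
  · convert bracket_rpow_mul_le_of_le (σ := σ) ha₂ ha₁ ha₄ ha₃ (by linarith) (by linarith)
      (by linarith) hx₂ hx₄ hM₂ hM₄ hM₁₂ hM₃₄ using 1
    · ring
    · congr 2; ring

/-- The reciprocal of the weight defining the wave-Sobolev norms. -/
def waveWeight (a b : ℝ) (X : SpaceTime) : ℝ≥0∞ :=
  ENNReal.ofReal ((1 + spFreq X ^ 2) ^ (-a)) * ENNReal.ofReal (modulation X ^ (-b))

theorem spFreq_neg (X : SpaceTime) : spFreq (-X) = spFreq X := by simp [spFreq]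

theorem spFreq_add_le (X Y : SpaceTime) : spFreq (X + Y) ≤ spFreq X + spFreq Y := by
  simp only [← norm_spComplex, spComplex_add, norm_add_le]

theorem spFreq_nonneg (X : SpaceTime) : 0 ≤ spFreq X := sqrt_nonneg _

theorem spFreq_add_eq_of_sum_eq_zero {X Y Z W : SpaceTime} (hsum : X + Y + Z + W = 0) :
    spFreq (Z + W) = spFreq (X + Y) := by
  rw [← spFreq_neg, ← eq_neg_of_add_eq_zero_left (by rw [← hsum]; abel : X + Y + (Z + W) = 0)]

theorem waveWeight_mul_le_of_le {σ a₁ a₂ a₃ a₄ : ℝ} (b₁ b₂ b₃ b₄ : ℝ)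
    (ha₁ : 0 ≤ a₁) (ha₂ : 0 ≤ a₂) (ha₃ : 0 ≤ a₃) (ha₄ : 0 ≤ a₄)
    (h₁₂₃ : σ ≤ a₁ + a₂ + a₃) (h₁₂₄ : σ ≤ a₁ + a₂ + a₄) (h₁₃₄ : σ ≤ a₁ + a₃ + a₄)
    (h₂₃₄ : σ ≤ a₂ + a₃ + a₄) (hall : 2 * σ ≤ a₁ + a₂ + a₃ + a₄)
    {X Y Z W : SpaceTime} (hsum : X + Y + Z + W = 0)
    (hX : 2 * spFreq X ≤ 3 * spFreq (X + Y)) (hY : 2 * spFreq Y ≤ 3 * spFreq (X + Y))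
    (hZ : 2 * spFreq Z ≤ 3 * spFreq (X + Y)) (hW : 2 * spFreq W ≤ 3 * spFreq (X + Y)) :
    waveWeight a₁ b₁ X * waveWeight a₂ b₂ Y * waveWeight a₃ b₃ Z * waveWeight a₄ b₄ W ≤
      ENNReal.ofReal (9 ^ (a₁ + a₂ + a₃ + a₄)) *
        (pairKernel σ b₁ b₂ X Y * pairKernel σ b₃ b₄ Z W) := by
  have hZW : spFreq (Z + W) = spFreq (X + Y) := spFreq_add_eq_of_sum_eq_zero hsum
  have hadd := spFreq_add_le X Y
  have hadd' := spFreq_add_le Z W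
  rw [hZW] at hadd'
  have hn := spFreq_nonneg (X + Y)
  have key := ENNReal.ofReal_le_ofReal <| bracket_rpow_mul_le (M := 3 / 2 * spFreq (X + Y))
    ha₁ ha₂ ha₃ ha₄ h₁₂₃ h₁₂₄ h₁₃₄ h₂₃₄ hall (spFreq_nonneg X) (spFreq_nonneg Y) (spFreq_nonneg Z)
    (spFreq_nonneg W) (by linarith) (by linarith) (by linarith) (by linarith)
    (by linarith [le_max_left (spFreq X) (spFreq Y), le_max_right (spFreq X) (spFreq Y)])
    (by linarith [le_max_left (spFreq Z) (spFreq W), le_max_right (spFreq Z) (spFreq W)])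
  rw [ENNReal.ofReal_mul (by positivity), ENNReal.ofReal_mul (by positivity),
    ENNReal.ofReal_mul (by positivity), ENNReal.ofReal_mul (by positivity),
    ENNReal.ofReal_mul (by positivity)] at key
  simp only [pairKernel, waveWeight, lowWeight]
  rw [if_pos (by linarith [min_le_left (spFreq X) (spFreq Y)]),
    if_pos (by linarith [min_le_left (spFreq Z) (spFreq W)])]
  set m := ENNReal.ofReal (modulation X ^ (-b₁)) * ENNReal.ofReal (modulation Y ^ (-b₂)) *
    (ENNReal.ofReal (modulation Z ^ (-b₃)) * ENNReal.ofReal (modulation W ^ (-b₄))) with hm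
  refine le_trans (le_of_eq ?_) ((mul_le_mul_right key m).trans (le_of_eq ?_))
  · rw [hm]; ring
  · rw [hm]; ring

theorem two_mul_spFreq_le (X Y Z : SpaceTime) :
    2 * spFreq X ≤ spFreq (X + Y) + spFreq (X + Z) + spFreq (Y + Z) := by
  have h : (2 : ℝ) * spFreq X = ‖(2 : ℂ) * spComplex X‖ := by
    rw [norm_mul, norm_spComplex]; norm_num
  have h2 : (2 : ℂ) * spComplex X =
      (spComplex X + spComplex Y) + (spComplex X + spComplex Z) - (spComplex Y + spComplex Z) := by
    ring
  rw [h, h2]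
  simp only [← norm_spComplex, spComplex_add]
  exact (norm_sub_le _ _).trans (by gcongr; exact norm_add_le _ _)

/-- The weights of four frequencies summing to zero are controlled by the kernels of the three ways
of pairing them. -/
theorem waveWeight_mul_le {σ a₁ a₂ a₃ a₄ : ℝ} (b₁ b₂ b₃ b₄ : ℝ)
    (ha₁ : 0 ≤ a₁) (ha₂ : 0 ≤ a₂) (ha₃ : 0 ≤ a₃) (ha₄ : 0 ≤ a₄)
    (h₁₂₃ : σ ≤ a₁ + a₂ + a₃) (h₁₂₄ : σ ≤ a₁ + a₂ + a₄) (h₁₃₄ : σ ≤ a₁ + a₃ + a₄)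
    (h₂₃₄ : σ ≤ a₂ + a₃ + a₄) (hall : 2 * σ ≤ a₁ + a₂ + a₃ + a₄)
    {X Y Z W : SpaceTime} (hsum : X + Y + Z + W = 0) :
    waveWeight a₁ b₁ X * waveWeight a₂ b₂ Y * waveWeight a₃ b₃ Z * waveWeight a₄ b₄ W ≤
      ENNReal.ofReal (9 ^ (a₁ + a₂ + a₃ + a₄)) *
        (pairKernel σ b₁ b₂ X Y * pairKernel σ b₃ b₄ Z W +
          pairKernel σ b₁ b₃ X Z * pairKernel σ b₂ b₄ Y W +
            pairKernel σ b₂ b₃ Y Z * pairKernel σ b₁ b₄ X W) := by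
  have e₁ : spFreq (Z + W) = spFreq (X + Y) := spFreq_add_eq_of_sum_eq_zero hsum
  have e₂ : spFreq (Y + W) = spFreq (X + Z) :=
    spFreq_add_eq_of_sum_eq_zero (by rw [← hsum]; abel)
  have e₃ : spFreq (X + W) = spFreq (Y + Z) :=
    spFreq_add_eq_of_sum_eq_zero (by rw [← hsum]; abel)
  have hX := two_mul_spFreq_le X Y Z
  have hY := two_mul_spFreq_le Y X Z
  have hZ := two_mul_spFreq_le Z X Y
  have hW := two_mul_spFreq_le W X Y
  rw [add_comm Y X] at hY
  rw [add_comm Z X, add_comm Z Y] at hZ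
  rw [add_comm W X, add_comm W Y, e₂, e₃] at hW
  have hmax : (spFreq (X + Z) ≤ spFreq (X + Y) ∧ spFreq (Y + Z) ≤ spFreq (X + Y)) ∨
      (spFreq (X + Y) ≤ spFreq (X + Z) ∧ spFreq (Y + Z) ≤ spFreq (X + Z)) ∨
      (spFreq (X + Y) ≤ spFreq (Y + Z) ∧ spFreq (X + Z) ≤ spFreq (Y + Z)) := by grind
  rcases hmax with ⟨h, h'⟩ | ⟨h, h'⟩ | ⟨h, h'⟩
  · refine (waveWeight_mul_le_of_le b₁ b₂ b₃ b₄ ha₁ ha₂ ha₃ ha₄ h₁₂₃ h₁₂₄ h₁₃₄ h₂₃₄ hall hsum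
      (by linarith) (by linarith) (by linarith) (by linarith)).trans ?_
    gcongr
    exact le_self_add.trans le_self_add
  · have := waveWeight_mul_le_of_le (σ := σ) b₁ b₃ b₂ b₄ ha₁ ha₃ ha₂ ha₄ (X := X) (Y := Z) (Z := Y)
      (W := W) (by linarith) (by linarith) (by linarith) (by linarith) (by linarith)
      (by rw [← hsum]; abel) (by linarith) (by linarith) (by linarith) (by linarith)
    rw [mul_right_comm (waveWeight a₁ b₁ X), add_right_comm a₁] at this
    refine this.trans ?_
    gcongr
    exact le_add_self.trans le_self_add
  · have := waveWeight_mul_le_of_le (σ := σ) b₂ b₃ b₁ b₄ ha₂ ha₃ ha₁ ha₄ (X := Y) (Y := Z) (Z := X)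
      (W := W) (by linarith) (by linarith) (by linarith) (by linarith) (by linarith)
      (by rw [← hsum]; abel) (by linarith) (by linarith) (by linarith) (by linarith)
    rw [mul_comm (_ * _) (waveWeight a₁ b₁ X), ← mul_assoc (waveWeight a₁ b₁ X),
      add_comm (a₂ + a₃), ← add_assoc a₁] at this
    refine this.trans ?_
    gcongr
    exact le_add_self

end Interaction

section Form

theorem measurable_waveWeight (a b : ℝ) : Measurable (waveWeight a b) := by
  have h1 := measurable_modulation
  have h2 := measurable_spFreq
  unfold waveWeight; fun_prop

section Swap

variable {α : Type*} [MeasurableSpace α] {μ : Measure α} [SFinite μ] {F : α → α → α → ℝ≥0∞}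

theorem lintegral_swap_inner (hF : Measurable fun x : α × α × α => F x.1 x.2.1 x.2.2) :
    ∫⁻ X, ∫⁻ Y, ∫⁻ Z, F X Y Z ∂μ ∂μ ∂μ = ∫⁻ X, ∫⁻ Z, ∫⁻ Y, F X Y Z ∂μ ∂μ ∂μ :=
  lintegral_congr fun X => lintegral_lintegral_swap
    (hF.comp (g := fun x : α × α × α => F x.1 x.2.1 x.2.2)
      (f := fun y : α × α => (X, y.1, y.2)) (by fun_prop)).aemeasurable

theorem lintegral_swap_outer (hF : Measurable fun x : α × α × α => F x.1 x.2.1 x.2.2) :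
    ∫⁻ X, ∫⁻ Y, ∫⁻ Z, F X Y Z ∂μ ∂μ ∂μ = ∫⁻ Y, ∫⁻ X, ∫⁻ Z, F X Y Z ∂μ ∂μ ∂μ :=
  lintegral_lintegral_swap (Measurable.lintegral_prod_right'
    (hF.comp (g := fun x : α × α × α => F x.1 x.2.1 x.2.2)
      (f := fun y : (α × α) × α => (y.1.1, y.1.2, y.2)) (by fun_prop))).aemeasurable

theorem lintegral_triple_eq (hF : Measurable fun x : α × α × α => F x.1 x.2.1 x.2.2) :
    ∫⁻ X, ∫⁻ Y, ∫⁻ Z, F X Y Z ∂μ ∂μ ∂μ = ∫⁻ x, F x.1 x.2.1 x.2.2 ∂(μ.prod (μ.prod μ)) := by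
  rw [lintegral_prod _ hF.aemeasurable]
  refine lintegral_congr fun X => ?_
  exact (lintegral_prod (fun y : α × α => F X y.1 y.2)
    (hF.comp (f := Prod.mk X) measurable_prodMk_left).aemeasurable).symm

theorem lintegral_triple_const_mul_add {G H : α → α → α → ℝ≥0∞} (K : ℝ≥0∞)
    (hF : Measurable fun x : α × α × α => F x.1 x.2.1 x.2.2)
    (hG : Measurable fun x : α × α × α => G x.1 x.2.1 x.2.2)
    (hH : Measurable fun x : α × α × α => H x.1 x.2.1 x.2.2) :
    ∫⁻ X, ∫⁻ Y, ∫⁻ Z, K * (F X Y Z + G X Y Z + H X Y Z) ∂μ ∂μ ∂μ =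
      K * ((∫⁻ X, ∫⁻ Y, ∫⁻ Z, F X Y Z ∂μ ∂μ ∂μ) + (∫⁻ X, ∫⁻ Y, ∫⁻ Z, G X Y Z ∂μ ∂μ ∂μ) +
        ∫⁻ X, ∫⁻ Y, ∫⁻ Z, H X Y Z ∂μ ∂μ ∂μ) := by
  rw [lintegral_triple_eq hF, lintegral_triple_eq hG, lintegral_triple_eq hH,
    ← lintegral_add_right _ hG, ← lintegral_add_right _ hH,
    ← lintegral_const_mul K (by exact (hF.add hG).add hH)]
  exact lintegral_triple_eq (((hF.add hG).add hH).const_mul K)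

end Swap

theorem measurable_pair_mul {α β : Type*} [MeasurableSpace α] [MeasurableSpace β]
    {f g : α → ℝ≥0∞} {p : α → α → ℝ≥0∞} (hf : Measurable f) (hg : Measurable g)
    (hp : Measurable (Function.uncurry p)) {A B : β → α} (hA : Measurable A) (hB : Measurable B) :
    Measurable fun x => f (A x) * g (B x) * p (A x) (B x) :=
  ((hf.comp hA).mul (hg.comp hB)).mul (hp.comp (hA.prodMk hB))

/-- The quadrilinear form dual to the trilinear estimate is bounded on `L²`. -/
theorem exists_sq_waveForm_le {σ a₁ a₂ a₃ a₄ b₁ b₂ b₃ b₄ : ℝ}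
    (ha₁ : 0 ≤ a₁) (ha₂ : 0 ≤ a₂) (ha₃ : 0 ≤ a₃) (ha₄ : 0 ≤ a₄)
    (h₁₂₃ : σ ≤ a₁ + a₂ + a₃) (h₁₂₄ : σ ≤ a₁ + a₂ + a₄) (h₁₃₄ : σ ≤ a₁ + a₃ + a₄)
    (h₂₃₄ : σ ≤ a₂ + a₃ + a₄) (hall : 2 * σ ≤ a₁ + a₂ + a₃ + a₄) (hσ : 3 / 8 < σ)
    (hb₁ : 1 / 2 < b₁) (hb₂ : 1 / 2 < b₂) (hb₃ : 1 / 2 < b₃) (hb₄ : 1 / 4 < b₄) :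
    ∃ C : ℝ≥0∞, C < ∞ ∧ ∀ f₁ f₂ f₃ f₄ : SpaceTime → ℝ≥0∞, Measurable f₁ → Measurable f₂ →
      Measurable f₃ → Measurable f₄ →
      (∫⁻ X, ∫⁻ Y, ∫⁻ Z, f₁ X * f₂ Y * f₃ Z * f₄ (-X - Y - Z) *
        (waveWeight a₁ b₁ X * waveWeight a₂ b₂ Y * waveWeight a₃ b₃ Z *
          waveWeight a₄ b₄ (-X - Y - Z))) ^ 2 ≤
      C * ((∫⁻ X, f₁ X ^ 2) * (∫⁻ X, f₂ X ^ 2) * (∫⁻ X, f₃ X ^ 2) * ∫⁻ X, f₄ X ^ 2) := by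
  obtain ⟨C₁₂, hC₁₂, h₁₂⟩ := exists_lintegral_pairKernel_sq_le hb₁ (by linarith : 1 / 4 < b₂) hσ
  obtain ⟨C₁₃, hC₁₃, h₁₃⟩ := exists_lintegral_pairKernel_sq_le hb₁ (by linarith : 1 / 4 < b₃) hσ
  obtain ⟨C₂₃, hC₂₃, h₂₃⟩ := exists_lintegral_pairKernel_sq_le hb₂ (by linarith : 1 / 4 < b₃) hσ
  obtain ⟨C₁₄, hC₁₄, h₁₄⟩ := exists_lintegral_pairKernel_sq_le hb₁ hb₄ hσ
  obtain ⟨C₂₄, hC₂₄, h₂₄⟩ := exists_lintegral_pairKernel_sq_le hb₂ hb₄ hσ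
  obtain ⟨C₃₄, hC₃₄, h₃₄⟩ := exists_lintegral_pairKernel_sq_le hb₃ hb₄ hσ
  set D := C₁₂ * C₃₄ + C₁₃ * C₂₄ + C₂₃ * C₁₄
  set K := ENNReal.ofReal (9 ^ (a₁ + a₂ + a₃ + a₄)) with hK
  refine ⟨(3 * K) ^ 2 * D, by finiteness, fun f₁ f₂ f₃ f₄ m₁ m₂ m₃ m₄ => ?_⟩
  set P := (∫⁻ X, f₁ X ^ 2) * (∫⁻ X, f₂ X ^ 2) * (∫⁻ X, f₃ X ^ 2) * ∫⁻ X, f₄ X ^ 2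
  have mk (b b' : ℝ) := measurable_pairKernel σ b b'
  set G₁ : SpaceTime → SpaceTime → SpaceTime → ℝ≥0∞ := fun X Y Z =>
    f₁ X * f₂ Y * pairKernel σ b₁ b₂ X Y *
      (f₃ Z * f₄ (-X - Y - Z) * pairKernel σ b₃ b₄ Z (-X - Y - Z)) with hG₁
  set G₂ : SpaceTime → SpaceTime → SpaceTime → ℝ≥0∞ := fun X Y Z =>
    f₁ X * f₃ Z * pairKernel σ b₁ b₃ X Z *
      (f₂ Y * f₄ (-X - Z - Y) * pairKernel σ b₂ b₄ Y (-X - Z - Y)) with hG₂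
  set G₃ : SpaceTime → SpaceTime → SpaceTime → ℝ≥0∞ := fun X Y Z =>
    f₂ Y * f₃ Z * pairKernel σ b₂ b₃ Y Z *
      (f₁ X * f₄ (-Y - Z - X) * pairKernel σ b₁ b₄ X (-Y - Z - X)) with hG₃
  have mG₁ : Measurable fun x : SpaceTime × SpaceTime × SpaceTime => G₁ x.1 x.2.1 x.2.2 := by
    exact (measurable_pair_mul m₁ m₂ (mk _ _) (by fun_prop) (by fun_prop)).mul
      (measurable_pair_mul m₃ m₄ (mk _ _) (by fun_prop) (by fun_prop))
  have mG₂ : Measurable fun x : SpaceTime × SpaceTime × SpaceTime => G₂ x.1 x.2.1 x.2.2 := by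
    exact (measurable_pair_mul m₁ m₃ (mk _ _) (by fun_prop) (by fun_prop)).mul
      (measurable_pair_mul m₂ m₄ (mk _ _) (by fun_prop) (by fun_prop))
  have mG₃ : Measurable fun x : SpaceTime × SpaceTime × SpaceTime => G₃ x.1 x.2.1 x.2.2 := by
    exact (measurable_pair_mul m₂ m₃ (mk _ _) (by fun_prop) (by fun_prop)).mul
      (measurable_pair_mul m₁ m₄ (mk _ _) (by fun_prop) (by fun_prop))
  have hroot {T : ℝ≥0∞} (hT : T ^ 2 ≤ D * P) : T ≤ (D * P) ^ (1 / 2 : ℝ) := by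
    rw [one_div, ENNReal.le_rpow_inv_iff (by norm_num)]
    exact_mod_cast hT
  have hT₁ : ∫⁻ X, ∫⁻ Y, ∫⁻ Z, G₁ X Y Z ≤ (D * P) ^ (1 / 2 : ℝ) := by
    refine hroot ((sq_quadrilinear_le volume m₁ m₂ m₃ m₄ (mk _ _) (mk _ _) h₁₂ h₃₄).trans ?_)
    calc _ = C₁₂ * C₃₄ * P := by ring
      _ ≤ D * P := by gcongr; exact le_self_add.trans le_self_add
  have hT₂ : ∫⁻ X, ∫⁻ Y, ∫⁻ Z, G₂ X Y Z ≤ (D * P) ^ (1 / 2 : ℝ) := by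
    rw [lintegral_swap_inner mG₂]
    refine hroot ((sq_quadrilinear_le volume m₁ m₃ m₂ m₄ (mk _ _) (mk _ _) h₁₃ h₂₄).trans ?_)
    calc _ = C₁₃ * C₂₄ * P := by ring
      _ ≤ D * P := by gcongr; exact le_add_self.trans le_self_add
  have hT₃ : ∫⁻ X, ∫⁻ Y, ∫⁻ Z, G₃ X Y Z ≤ (D * P) ^ (1 / 2 : ℝ) := by
    rw [lintegral_swap_outer mG₃, lintegral_swap_inner (F := fun Y X Z => G₃ X Y Z)
      (mG₃.comp (g := fun x : SpaceTime × SpaceTime × SpaceTime => G₃ x.1 x.2.1 x.2.2)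
      (f := fun x : SpaceTime × SpaceTime × SpaceTime => (x.2.1, x.1, x.2.2)) (by fun_prop))]
    refine hroot ((sq_quadrilinear_le volume m₂ m₃ m₁ m₄ (mk _ _) (mk _ _) h₂₃ h₁₄).trans ?_)
    calc _ = C₂₃ * C₁₄ * P := by ring
      _ ≤ D * P := by gcongr; exact le_add_self
  calc _ ≤ (∫⁻ X, ∫⁻ Y, ∫⁻ Z, K * (G₁ X Y Z + G₂ X Y Z + G₃ X Y Z)) ^ 2 := by
        refine pow_le_pow_left' (lintegral_mono fun X => lintegral_mono fun Y =>
          lintegral_mono fun Z => ?_) 2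
        refine (mul_le_mul_right (waveWeight_mul_le b₁ b₂ b₃ b₄ ha₁ ha₂ ha₃ ha₄ h₁₂₃ h₁₂₄ h₁₃₄
          h₂₃₄ hall (by abel : X + Y + Z + (-X - Y - Z) = 0)) _).trans (le_of_eq ?_)
        simp only [hG₁, hG₂, hG₃, ← hK]
        rw [sub_right_comm (-X) Z Y, show -Y - Z - X = -X - Y - Z by abel]
        ring
    _ = (K * ((∫⁻ X, ∫⁻ Y, ∫⁻ Z, G₁ X Y Z) + (∫⁻ X, ∫⁻ Y, ∫⁻ Z, G₂ X Y Z) +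
          ∫⁻ X, ∫⁻ Y, ∫⁻ Z, G₃ X Y Z)) ^ 2 := by
        rw [lintegral_triple_const_mul_add K mG₁ mG₂ mG₃]
    _ ≤ (K * ((D * P) ^ (1 / 2 : ℝ) + (D * P) ^ (1 / 2 : ℝ) + (D * P) ^ (1 / 2 : ℝ))) ^ 2 := by
        gcongr
    _ = (3 * K) ^ 2 * ((D * P) ^ (1 / 2 : ℝ)) ^ 2 := by ring
    _ = (3 * K) ^ 2 * D * P := by
        rw [← ENNReal.rpow_natCast ((D * P) ^ _), ← ENNReal.rpow_mul]
        norm_num [mul_assoc]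

end Form

section Product

/-- The pointwise product of two complex-valued Schwartz functions. -/
def schwartzMul (f g : SchwartzMap SpaceTime ℂ) : SchwartzMap SpaceTime ℂ :=
  SchwartzMap.pairing (ContinuousLinearMap.mul ℂ ℂ) f g

theorem schwartzMul_apply (f g : SchwartzMap SpaceTime ℂ) (x : SpaceTime) :
    schwartzMul f g x = f x * g x := rfl

theorem fourier_schwartzMul (f g : SchwartzMap SpaceTime ℂ) (ζ : SpaceTime) :
    𝓕 (schwartzMul f g) ζ = ∫ X, 𝓕 f X * 𝓕 g (ζ - X) := by
  have hinv : 𝓕⁻ (schwartzMul f g) =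
      SchwartzMap.convolution (ContinuousLinearMap.mul ℂ ℂ) (𝓕⁻ f) (𝓕⁻ g) := by
    rw [← FourierTransform.fourierInv_fourier_eq (E := SchwartzMap SpaceTime ℂ)
      (F := SchwartzMap SpaceTime ℂ)
      (SchwartzMap.convolution (ContinuousLinearMap.mul ℂ ℂ) (𝓕⁻ f) (𝓕⁻ g)),
      SchwartzMap.fourier_convolution, FourierTransform.fourier_fourierInv_eq,
      FourierTransform.fourier_fourierInv_eq]
    rfl
  have hneg (h : SchwartzMap SpaceTime ℂ) (x : SpaceTime) : 𝓕⁻ h x = 𝓕 h (-x) := by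
    rw [SchwartzMap.fourierInv_coe, SchwartzMap.fourier_coe, fourierInv_eq_fourier_neg]
  calc 𝓕 (schwartzMul f g) ζ = 𝓕⁻ (schwartzMul f g) (-ζ) := by rw [hneg, neg_neg]
    _ = ∫ X, 𝓕⁻ f X * 𝓕⁻ g (-ζ - X) := by
        rw [hinv, SchwartzMap.convolution_apply]; rfl
    _ = ∫ X, 𝓕⁻ f (-X) * 𝓕⁻ g (-ζ - -X) :=
        (integral_neg_eq_self (fun X => 𝓕⁻ f X * 𝓕⁻ g (-ζ - X)) volume).symm
    _ = _ := by
        refine integral_congr_ae (.of_forall fun X => ?_)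
        simp only [hneg, neg_neg, neg_sub, neg_sub_neg]

theorem enorm_fourier_schwartzMul_le (f g : SchwartzMap SpaceTime ℂ) (ζ : SpaceTime) :
    ‖𝓕 (schwartzMul f g) ζ‖ₑ ≤ ∫⁻ X, ‖𝓕 f X‖ₑ * ‖𝓕 g (ζ - X)‖ₑ := by
  rw [fourier_schwartzMul]
  refine (enorm_integral_le_lintegral_enorm _).trans (le_of_eq ?_)
  simp only [enorm_mul]

theorem enorm_fourier_schwartzMul_mul_le (u v w : SchwartzMap SpaceTime ℂ) (ζ : SpaceTime) :
    ‖𝓕 (schwartzMul u (schwartzMul v w)) ζ‖ₑ ≤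
      ∫⁻ X, ∫⁻ Y, ‖𝓕 u X‖ₑ * ‖𝓕 v Y‖ₑ * ‖𝓕 w (ζ - X - Y)‖ₑ := by
  refine (enorm_fourier_schwartzMul_le _ _ _).trans (lintegral_mono fun X => ?_)
  simp only [mul_assoc]
  rw [lintegral_const_mul' _ _ enorm_ne_top]
  gcongr
  exact enorm_fourier_schwartzMul_le _ _ _

end Product

section Energy

/-- The square of the wave-Sobolev norm, with values in `[0, ∞]`. -/
def waveEnergy (s b : ℝ) (f : SchwartzMap SpaceTime ℂ) : ℝ≥0∞ :=
  ∫⁻ ζ, (‖𝓕 f ζ‖ₑ * waveWeight (-(s / 2)) (-b) ζ) ^ 2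

theorem waveWeight_mul_waveWeight_neg (a b : ℝ) (X : SpaceTime) :
    waveWeight (-a) (-b) X * waveWeight a b X = 1 := by
  have h1 : 0 < 1 + spFreq X ^ 2 := by positivity
  have h2 : 0 < modulation X := zero_lt_one.trans_le (one_le_modulation X)
  rw [waveWeight, waveWeight, mul_mul_mul_comm, ← ENNReal.ofReal_mul (by positivity),
    ← ENNReal.ofReal_mul (by positivity), ← rpow_add h1, ← rpow_add h2]
  simp

theorem spFreq_le_norm (X : SpaceTime) : spFreq X ≤ ‖X‖ := by
  rw [spFreq, EuclideanSpace.norm_eq]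
  refine sqrt_le_sqrt ?_
  simp only [Fin.sum_univ_three, Real.norm_eq_abs, sq_abs]
  nlinarith [sq_nonneg (X 0)]

theorem modulation_le (X : SpaceTime) : modulation X ≤ 1 + ‖X‖ := by
  have h0 : |X 0| ≤ ‖X‖ := PiLp.norm_apply_le X 0
  have := spFreq_le_norm X
  have := spFreq_nonneg X
  rw [modulation, add_le_add_iff_left, abs_le]
  constructor <;> linarith [abs_nonneg (X 0)]

theorem exists_weight_le_pow (s b : ℝ) :
    ∃ n : ℕ, ∀ X : SpaceTime,
      (1 + spFreq X ^ 2) ^ s * modulation X ^ (2 * b) ≤ (1 + ‖X‖) ^ n := by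
  obtain ⟨n, hn⟩ := exists_nat_ge (2 * |s| + 2 * |b|)
  refine ⟨n, fun X => ?_⟩
  have hX : 1 ≤ 1 + ‖X‖ := le_add_of_nonneg_right (norm_nonneg X)
  have h0 := spFreq_nonneg X
  calc (1 + spFreq X ^ 2) ^ s * modulation X ^ (2 * b)
      ≤ ((1 + ‖X‖) ^ 2) ^ |s| * (1 + ‖X‖) ^ (2 * |b|) := by
        gcongr
        · exact rpow_nonneg (zero_le_one.trans (one_le_modulation X)) _
        · exact (rpow_le_rpow_of_exponent_le (by nlinarith) (le_abs_self s)).trans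
            (rpow_le_rpow (by positivity) (by nlinarith [spFreq_le_norm X]) (abs_nonneg s))
        · exact (rpow_le_rpow_of_exponent_le (one_le_modulation X)
            (by linarith [le_abs_self b])).trans
            (rpow_le_rpow (by linarith [one_le_modulation X]) (modulation_le X) (by positivity))
    _ = (1 + ‖X‖) ^ (2 * |s| + 2 * |b|) := by
        rw [rpow_add (by positivity), rpow_mul (by positivity) 2 |s|, rpow_two]
    _ ≤ (1 + ‖X‖) ^ n := by
        rw [← rpow_natCast]; exact rpow_le_rpow_of_exponent_le hX hn

theorem integrable_one_add_norm_pow_mul_norm_sq (g : SchwartzMap SpaceTime ℂ) (n : ℕ) :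
    Integrable fun X => (1 + ‖X‖) ^ n * ‖g X‖ ^ 2 := by
  set M := SchwartzMap.seminorm ℝ 0 0 g
  have hint : Integrable fun X => 2 ^ (n - 1) * M * (‖g X‖ + ‖X‖ ^ n * ‖g X‖) :=
    (g.integrable.norm.add (g.integrable_pow_mul volume n)).const_mul _
  refine hint.mono' (by fun_prop) (.of_forall fun X => ?_)
  rw [Real.norm_of_nonneg (by positivity)]
  calc (1 + ‖X‖) ^ n * ‖g X‖ ^ 2 ≤ (2 ^ (n - 1) * (1 ^ n + ‖X‖ ^ n)) * (M * ‖g X‖) := by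
        gcongr
        · exact add_pow_le zero_le_one (norm_nonneg X) n
        · rw [sq]; gcongr; exact g.norm_le_seminorm ℝ X
    _ = _ := by ring

theorem measurable_weight (s b : ℝ) :
    Measurable fun X => (1 + spFreq X ^ 2) ^ s * modulation X ^ (2 * b) := by
  have := measurable_spFreq
  have := measurable_modulation
  fun_prop

theorem integrable_waveNorm (s b : ℝ) (f : SchwartzMap SpaceTime ℂ) :
    Integrable fun X => (1 + spFreq X ^ 2) ^ s * modulation X ^ (2 * b) * ‖𝓕 f X‖ ^ 2 := by
  obtain ⟨n, hn⟩ := exists_weight_le_pow s b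
  refine (integrable_one_add_norm_pow_mul_norm_sq (𝓕 f) n).mono'
    ((measurable_weight s b).aestronglyMeasurable.mul (by fun_prop)) (.of_forall fun X => ?_)
  have := zero_le_one.trans (one_le_modulation X)
  rw [Real.norm_of_nonneg (by positivity)]
  gcongr
  exact hn X

theorem waveEnergy_eq (s b : ℝ) (f : SchwartzMap SpaceTime ℂ) :
    waveEnergy s b f = ∫⁻ X, ENNReal.ofReal
      ((1 + spFreq X ^ 2) ^ s * modulation X ^ (2 * b) * ‖𝓕 f X‖ ^ 2) := by
  refine lintegral_congr fun X => ?_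
  have h1 : 0 ≤ 1 + spFreq X ^ 2 := by positivity
  have h2 := zero_le_one.trans (one_le_modulation X)
  rw [waveWeight, ← ofReal_norm, ← ENNReal.ofReal_mul (by positivity),
    ← ENNReal.ofReal_mul (by positivity), ← ENNReal.ofReal_pow (by positivity), mul_pow, mul_pow,
    ← rpow_mul_natCast h1, ← rpow_mul_natCast h2, mul_comm]
  congr 4 <;> push_cast <;> ring

theorem waveEnergy_lt_top (s b : ℝ) (f : SchwartzMap SpaceTime ℂ) : waveEnergy s b f < ∞ := by
  rw [waveEnergy_eq]
  exact (integrable_waveNorm s b f).lintegral_lt_top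

theorem waveNorm_eq (s b : ℝ) (f : SchwartzMap SpaceTime ℂ) :
    waveNorm s b f = (waveEnergy s b f).toReal ^ (1 / 2 : ℝ) := by
  rw [waveEnergy_eq, ← integral_eq_lintegral_of_nonneg_ae (.of_forall fun X => ?_)
    (integrable_waveNorm s b f).aestronglyMeasurable]
  · rfl
  · have := zero_le_one.trans (one_le_modulation X)
    positivity

end Energy

section Duality

theorem modulation_neg (X : SpaceTime) : modulation (-X) = modulation X := by
  simp [modulation, spFreq_neg]

theorem waveWeight_neg (a b : ℝ) (X : SpaceTime) : waveWeight a b (-X) = waveWeight a b X := by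
  rw [waveWeight, waveWeight, modulation_neg, spFreq_neg]

/-- Pairing a function dominated by a threefold convolution with a weight `h`. -/
theorem lintegral_mul_convolution_eq {E : Type*} [AddCommGroup E] [MeasurableSpace E]
    [MeasurableAdd₂ E] [MeasurableNeg E] (μ : Measure E) [SFinite μ] [μ.IsAddLeftInvariant]
    {h g₁ g₂ g₃ : E → ℝ≥0∞} (mh : Measurable h) (m₁ : Measurable g₁) (m₂ : Measurable g₂)
    (m₃ : Measurable g₃) :
    ∫⁻ ζ, h ζ * ∫⁻ X, ∫⁻ Y, g₁ X * g₂ Y * g₃ (ζ - X - Y) ∂μ ∂μ ∂μ =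
      ∫⁻ X, ∫⁻ Y, ∫⁻ Z, g₁ X * g₂ Y * g₃ Z * h (X + Y + Z) ∂μ ∂μ ∂μ := by
  have hm : Measurable fun x : E × E × E =>
      h x.1 * (g₁ x.2.1 * g₂ x.2.2 * g₃ (x.1 - x.2.1 - x.2.2)) := by fun_prop
  calc _ = ∫⁻ ζ, ∫⁻ X, ∫⁻ Y, h ζ * (g₁ X * g₂ Y * g₃ (ζ - X - Y)) ∂μ ∂μ ∂μ := by
        refine lintegral_congr fun ζ => ?_
        have hX (X : E) : Measurable fun Y => g₁ X * g₂ Y * g₃ (ζ - X - Y) := by fun_prop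
        have hXY : Measurable fun x : E × E => g₁ x.1 * g₂ x.2 * g₃ (ζ - x.1 - x.2) := by fun_prop
        rw [← lintegral_const_mul _ hXY.lintegral_prod_right']
        exact lintegral_congr fun X => (lintegral_const_mul _ (hX X)).symm
    _ = ∫⁻ X, ∫⁻ Y, ∫⁻ ζ, h ζ * (g₁ X * g₂ Y * g₃ (ζ - X - Y)) ∂μ ∂μ ∂μ := by
        rw [lintegral_swap_outer hm]
        exact lintegral_swap_inner (F := fun X ζ Y => h ζ * (g₁ X * g₂ Y * g₃ (ζ - X - Y)))
          (by fun_prop)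
    _ = _ := by
        refine lintegral_congr fun X => lintegral_congr fun Y => ?_
        rw [← lintegral_add_left_eq_self _ (X + Y)]
        refine lintegral_congr fun Z => ?_
        rw [show X + Y + Z - X - Y = Z by abel, mul_comm]

theorem exists_waveEnergy_mul_le {σ s₁ s₂ s₃ s₄ b₁ b₂ b₃ b₄ : ℝ}
    (hs₁ : 0 ≤ s₁) (hs₂ : 0 ≤ s₂) (hs₃ : 0 ≤ s₃) (hs₄ : s₄ ≤ 0)
    (h₁₂₃ : σ ≤ s₁ + s₂ + s₃) (h₁₂₄ : σ ≤ s₁ + s₂ - s₄) (h₁₃₄ : σ ≤ s₁ + s₃ - s₄)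
    (h₂₃₄ : σ ≤ s₂ + s₃ - s₄) (hall : 2 * σ ≤ s₁ + s₂ + s₃ - s₄) (hσ : 3 / 4 < σ)
    (hb₁ : 1 / 2 < b₁) (hb₂ : 1 / 2 < b₂) (hb₃ : 1 / 2 < b₃) (hb₄ : b₄ < -(1 / 4)) :
    ∃ C : ℝ≥0∞, C < ∞ ∧ ∀ u v w : SchwartzMap SpaceTime ℂ,
      waveEnergy s₄ b₄ (schwartzMul u (schwartzMul v w)) ≤
        C * (waveEnergy s₁ b₁ u * waveEnergy s₂ b₂ v * waveEnergy s₃ b₃ w) := by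
  obtain ⟨C, hC, hle⟩ := exists_sq_waveForm_le (σ := σ / 2) (a₁ := s₁ / 2) (a₂ := s₂ / 2)
    (a₃ := s₃ / 2) (a₄ := -(s₄ / 2)) (b₁ := b₁) (b₂ := b₂) (b₃ := b₃) (b₄ := -b₄)
    (by linarith) (by linarith) (by linarith) (by linarith) (by linarith) (by linarith)
    (by linarith) (by linarith) (by linarith) (by linarith) hb₁ hb₂ hb₃ (by linarith)
  refine ⟨C, hC, fun u v w => ?_⟩
  set A := waveEnergy s₄ b₄ (schwartzMul u (schwartzMul v w))
  set W := waveWeight (-(s₄ / 2)) (-b₄) with hW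
  set G : SpaceTime → ℝ≥0∞ := fun ζ => ‖𝓕 (schwartzMul u (schwartzMul v w)) ζ‖ₑ * W ζ with hG
  have mW : Measurable W := measurable_waveWeight _ _
  have mF (f : SchwartzMap SpaceTime ℂ) : Measurable fun ζ => ‖𝓕 f ζ‖ₑ :=
    (𝓕 f).continuous.measurable.enorm
  have mG : Measurable G := (mF _).mul mW
  have mE (f : SchwartzMap SpaceTime ℂ) (s b : ℝ) :
      Measurable fun ζ => ‖𝓕 f ζ‖ₑ * waveWeight (-(s / 2)) (-b) ζ :=
    (mF f).mul (measurable_waveWeight _ _)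
  have hG4 : ∫⁻ X, G (-X) ^ 2 = A := lintegral_neg_eq_self (μ := volume) fun X => G X ^ 2
  have hform : A ≤ ∫⁻ X, ∫⁻ Y, ∫⁻ Z,
      (‖𝓕 u X‖ₑ * waveWeight (-(s₁ / 2)) (-b₁) X) * (‖𝓕 v Y‖ₑ * waveWeight (-(s₂ / 2)) (-b₂) Y) *
        (‖𝓕 w Z‖ₑ * waveWeight (-(s₃ / 2)) (-b₃) Z) * G (-(-X - Y - Z)) *
        (waveWeight (s₁ / 2) b₁ X * waveWeight (s₂ / 2) b₂ Y * waveWeight (s₃ / 2) b₃ Z *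
          W (-X - Y - Z)) := by
    calc A ≤ ∫⁻ ζ, G ζ * W ζ *
          ∫⁻ X, ∫⁻ Y, ‖𝓕 u X‖ₑ * ‖𝓕 v Y‖ₑ * ‖𝓕 w (ζ - X - Y)‖ₑ := by
          refine lintegral_mono fun ζ => ?_
          rw [sq]
          calc _ = G ζ * W ζ * ‖𝓕 (schwartzMul u (schwartzMul v w)) ζ‖ₑ := by
                simp only [hG]; ring
            _ ≤ _ := by gcongr; exact enorm_fourier_schwartzMul_mul_le u v w ζ
      _ = _ := lintegral_mul_convolution_eq volume (h := fun ζ => G ζ * W ζ) (mG.mul mW) (mF u)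
          (mF v) (mF w)
      _ = _ := by
          refine lintegral_congr fun X => lintegral_congr fun Y => lintegral_congr fun Z => ?_
          have hWn : W (-X - Y - Z) = W (X + Y + Z) := by
            rw [hW, ← waveWeight_neg]; congr 1; abel
          rw [hWn, show -(-X - Y - Z) = X + Y + Z by abel]
          calc _ = ‖𝓕 u X‖ₑ * (waveWeight (-(s₁ / 2)) (-b₁) X * waveWeight (s₁ / 2) b₁ X) *
                (‖𝓕 v Y‖ₑ * (waveWeight (-(s₂ / 2)) (-b₂) Y * waveWeight (s₂ / 2) b₂ Y)) *
                (‖𝓕 w Z‖ₑ * (waveWeight (-(s₃ / 2)) (-b₃) Z * waveWeight (s₃ / 2) b₃ Z)) *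
                (G (X + Y + Z) * W (X + Y + Z)) := by
                simp only [waveWeight_mul_waveWeight_neg, mul_one]
            _ = _ := by ring
  have hsq : A ^ 2 ≤ C * (waveEnergy s₁ b₁ u * waveEnergy s₂ b₂ v * waveEnergy s₃ b₃ w) * A := by
    refine (pow_le_pow_left' hform 2).trans ((hle _ _ _ (fun X => G (-X)) (mE u s₁ b₁) (mE v s₂ b₂)
      (mE w s₃ b₃) (mG.comp measurable_neg)).trans (le_of_eq ?_))
    rw [hG4, ← mul_assoc C]; rfl
  rcases eq_or_ne A 0 with h0 | h0
  · rw [h0]; exact zero_le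
  · rw [sq] at hsq
    exact (ENNReal.mul_le_mul_iff_left h0 (waveEnergy_lt_top _ _ _).ne).1 hsq

end Duality

theorem cubic_phi_estimate (s s' θ₀ θ₁ : ℝ)
    (hs : 1/4 < s) (hs1 : s ≤ 1) (hs' : 1/4 < s') (hs'1 : s' ≤ 1/2)
    (hss' : s < 2 * s' + 1/4)
    (hθ0 : 1/2 < θ₀) (hθ0b : θ₀ < 3/4) (hθ1 : 1/2 < θ₁) (hθ1b : θ₁ < 3/4) :
    ∃ ε₀ > 0, ∀ ε : ℝ, 0 < ε → ε ≤ ε₀ → ∃ C > 0, ∀ u v w : SchwartzMap SpaceTime ℂ,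
      waveNorm (s - 1) (θ₀ - 1 + ε) (fun x => u x * v x * w x) ≤
        C * waveNorm s θ₀ (fun x => u x) * waveNorm s' θ₁ (fun x => v x) *
          waveNorm s' θ₁ (fun x => w x) := by
  refine ⟨(3 / 4 - θ₀) / 2, by linarith, fun ε hε hε' => ?_⟩
  obtain ⟨σ, hσ, hσ'⟩ := exists_between
    (show 3 / 4 < min (min (s + 2 * s') (2 * s' + 1 - s)) (s' + 1 / 2) from
      lt_min (lt_min (by linarith) (by linarith)) (by linarith))
  obtain ⟨hσ₀, hσ₃⟩ := lt_min_iff.1 hσ'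
  obtain ⟨hσ₁, hσ₂⟩ := lt_min_iff.1 hσ₀
  obtain ⟨C, hC, hle⟩ := exists_waveEnergy_mul_le (σ := σ) (s₁ := s) (s₂ := s') (s₃ := s')
    (s₄ := s - 1) (b₁ := θ₀) (b₂ := θ₁) (b₃ := θ₁) (b₄ := θ₀ - 1 + ε)
    (by linarith) (by linarith) (by linarith) (by linarith) (by linarith) (by linarith)
    (by linarith) (by linarith) (by linarith) hσ hθ0 hθ1 hθ1 (by linarith)
  refine ⟨(C.toReal + 1) ^ (1 / 2 : ℝ), by positivity, fun u v w => ?_⟩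
  have hprod : (fun x => u x * v x * w x) = ⇑(schwartzMul u (schwartzMul v w)) :=
    funext fun x => by simp only [schwartzMul_apply, mul_assoc]
  rw [hprod, waveNorm_eq, waveNorm_eq, waveNorm_eq, waveNorm_eq,
    ← mul_rpow (by positivity) (by positivity), ← mul_rpow (by positivity) (by positivity),
    ← mul_rpow (by positivity) (by positivity)]
  refine rpow_le_rpow (by positivity) ?_ (by norm_num)
  calc _ ≤ (C * (waveEnergy s θ₀ u * waveEnergy s' θ₁ v * waveEnergy s' θ₁ w)).toReal := by
        refine ENNReal.toReal_mono ?_ (hle u v w)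
        have := waveEnergy_lt_top s θ₀ u
        have := waveEnergy_lt_top s' θ₁ v
        have := waveEnergy_lt_top s' θ₁ w
        finiteness
    _ = C.toReal * (waveEnergy s θ₀ u).toReal * (waveEnergy s' θ₁ v).toReal *
          (waveEnergy s' θ₁ w).toReal := by
        simp only [ENNReal.toReal_mul, mul_assoc]
    _ ≤ _ := by gcongr; linarith

end
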